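/- arXiv:2409.07546 — 8 statements merged into one kernel-verified Lean document; each statement's English description precedes it below -/
import Mathlib

section
/- Persistence of localized synchrony patterns in the bistability region: Assume λ satisfies Hypothesis 1 and ω satisfies Hypothesis 2. Fix integers N ≥ 2 and 1 ≤ k < N, a compact interval I ⊂ (0,1), and a pattern p : {1,…,k} → {−,+}. Then there exist ε_* > 0 and C > 0 such that for every ε ∈ (0, ε_*) and every μ ∈ I the dissipative oscillator system at parameters (μ, ε) has an off-site solution (r, φ, ρ) (and likewise an on-site solution) satisfying |r_n − r_{p(n)}(μ)| ≤ C ε for 1 ≤ n ≤ k, |r_n| ≤ C ε^{n−k} for k+1 ≤ n ≤ N, |φ_n| ≤ C ε for 1 ≤ n ≤ N−1, and |ρ − ω_0(μ)| ≤ C ε. -/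
noncomputable section

open Set

/-- Extension of the amplitude sequence by the boundary conventions:
`r 0 := r 2` (on-site) or `r 0 := r 1` (off-site), and `r (N+1) := r N`. -/
def extR (N : ℕ) (onsite : Bool) (r : ℕ → ℝ) (n : ℕ) : ℝ :=
  if n = 0 then (if onsite then r 2 else r 1) else if n = N + 1 then r N else r n

/-- Extension of the phase-difference sequence by the boundary conventions:
`φ 0 := -φ 1` (on-site) or `φ 0 := 0` (off-site), and `φ N := 0`. -/
def extPhi (N : ℕ) (onsite : Bool) (φ : ℕ → ℝ) (n : ℕ) : ℝ :=
  if n = 0 then (if onsite then -φ 1 else 0) else if n = N then 0 else φ n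

/-- `(r, φ, ρ)` is an on-site (`onsite = true`) or off-site (`onsite = false`)
solution of the dissipative oscillator system at parameters `(μ, ε)`. -/
def DissipSol (N : ℕ) (onsite : Bool) (lam : ℝ → ℝ → ℝ) (om : ℝ → ℝ → ℝ → ℝ)
    (μ ε : ℝ) (r φ : ℕ → ℝ) (ρ : ℝ) : Prop :=
  ∀ n, 1 ≤ n → n ≤ N →
    lam (extR N onsite r n) μ * extR N onsite r n
      + ε * (extR N onsite r (n + 1) * Real.cos (extPhi N onsite φ n)
          - 2 * extR N onsite r n
          + extR N onsite r (n - 1) * Real.cos (extPhi N onsite φ (n - 1))) = 0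
    ∧ (om (extR N onsite r n) μ ε - ρ) * extR N onsite r n
      + ε * (extR N onsite r (n + 1) * Real.sin (extPhi N onsite φ n)
          - extR N onsite r (n - 1) * Real.sin (extPhi N onsite φ (n - 1))) = 0

/-- Hypothesis 1 (bistability). -/
structure Hyp1 (lam : ℝ → ℝ → ℝ) (rm rp : ℝ → ℝ) : Prop where
  smooth : ∀ n : ℕ, ContDiff ℝ n (fun p : ℝ × ℝ => lam p.1 p.2)
  even : ∀ r μ, lam (-r) μ = lam r μ
  rm_cont : ContinuousOn rm (Ioo 0 1)
  rp_cont : ContinuousOn rp (Ioo 0 1)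
  rm_pos : ∀ μ ∈ Ioo (0:ℝ) 1, 0 < rm μ
  rm_lt_rp : ∀ μ ∈ Ioo (0:ℝ) 1, rm μ < rp μ
  roots : ∀ μ ∈ Ioo (0:ℝ) 1, ∀ r : ℝ, 0 < r → (lam r μ = 0 ↔ r = rm μ ∨ r = rp μ)
  lam0_neg : ∀ μ ∈ Ioo (0:ℝ) 1, lam 0 μ < 0
  stab_p : ∀ μ ∈ Ioo (0:ℝ) 1, deriv (fun r => lam r μ) (rp μ) < 0
  stab_m : ∀ μ ∈ Ioo (0:ℝ) 1, 0 < deriv (fun r => lam r μ) (rm μ)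

/-- Hypothesis 2: `ω(r, μ, ε) = ω₀(μ) + ε² ω₂(r, μ, ε)` with `ω₀, ω₂` smooth. -/
def Hyp2 (om : ℝ → ℝ → ℝ → ℝ) (ω0 : ℝ → ℝ) (ω2 : ℝ → ℝ → ℝ → ℝ) : Prop :=
  (∀ n : ℕ, ContDiff ℝ n ω0) ∧
  (∀ n : ℕ, ContDiff ℝ n (fun p : ℝ × ℝ × ℝ => ω2 p.1 p.2.1 p.2.2)) ∧
  ∀ r μ ε, om r μ ε = ω0 μ + ε ^ 2 * ω2 r μ ε

open Filter Topology

/-- Zeros of a `C¹` map persist under perturbation of a parameter, with linear control of the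
displacement, as long as the linearization in the state variable is injective. -/
theorem exists_perturbed_zero {E : Type*} [NormedAddCommGroup E] [NormedSpace ℝ E]
    [FiniteDimensional ℝ E] {f : (ℝ × ℝ) × E → E} {x₀ : ℝ → E} {μ₀ : ℝ}
    (hf : ContDiffAt ℝ 1 f ((μ₀, 0), x₀ μ₀)) (hx₀ : ContinuousAt x₀ μ₀)
    (hzero : ∀ᶠ μ in 𝓝 μ₀, f ((μ, 0), x₀ μ) = 0)
    (hinj : ∀ v, HasDerivAt (fun t : ℝ => f ((μ₀, 0), x₀ μ₀ + t • v)) 0 0 → v = 0)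
    {P : (ℝ × ℝ) × E → Prop} (hP : ∀ᶠ z in 𝓝 ((μ₀, (0 : ℝ)), x₀ μ₀), P z) :
    ∃ K : ℝ, ∀ᶠ q in 𝓝 (μ₀, (0 : ℝ)),
      ∃ x, f (q, x) = 0 ∧ P (q, x) ∧ ‖x - x₀ q.1‖ ≤ K * |q.2| := by
  have : CompleteSpace E := FiniteDimensional.complete ℝ E
  obtain ⟨f', hstrict⟩ : ∃ f', HasStrictFDerivAt f f' ((μ₀, (0 : ℝ)), x₀ μ₀) :=
    ⟨_, hf.hasStrictFDerivAt one_ne_zero⟩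
  have hker : Function.Injective (f' ∘L .inr ℝ (ℝ × ℝ) E) := by
    rw [injective_iff_map_eq_zero]
    intro v hv
    apply hinj v
    have hline : HasDerivAt (fun t : ℝ => ((μ₀, (0 : ℝ)), x₀ μ₀ + t • v)) (0, v) 0 := by
      have h := ((hasDerivAt_id (0 : ℝ)).smul_const v).const_add (x₀ μ₀)
      simpa using (hasDerivAt_const (0 : ℝ) (μ₀, (0 : ℝ))).prodMk h
    have h := HasFDerivAt.comp_hasDerivAt (0 : ℝ) (l := f)
      (by simpa using hstrict.hasFDerivAt) hline
    have hv' : f' (0, v) = 0 := by simpa using hv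
    rw [hv'] at h
    exact h
  have hinv : (f' ∘L .inr ℝ (ℝ × ℝ) E).IsInvertible := by
    refine ⟨(LinearEquiv.ofInjectiveEndo (f' ∘L .inr ℝ (ℝ × ℝ) E).toLinearMap
      hker).toContinuousLinearEquiv, ?_⟩
    ext v
    rfl
  set g := hstrict.implicitFunctionOfProdDomain hinv
  have hg : Tendsto g (𝓝 (μ₀, 0)) (𝓝 (x₀ μ₀)) :=
    hstrict.tendsto_implicitFunctionOfProdDomain hinv
  have hbase : f ((μ₀, 0), x₀ μ₀) = 0 := hzero.self_of_nhds
  have hsol : ∀ᶠ q in 𝓝 (μ₀, (0 : ℝ)), f (q, g q) = 0 := by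
    have h := hstrict.eventually_apply_implicitFunctionOfProdDomain hinv
    rwa [hbase] at h
  have huniq : ∀ᶠ μ in 𝓝 μ₀, g (μ, 0) = x₀ μ := by
    have ht : Tendsto (fun μ => ((μ, (0 : ℝ)), x₀ μ)) (𝓝 μ₀) (𝓝 ((μ₀, 0), x₀ μ₀)) :=
      ((continuousAt_id.prodMk continuousAt_const).prodMk hx₀)
    filter_upwards [ht.eventually
      (hstrict.eventually_apply_eq_iff_implicitFunctionOfProdDomain hinv), hzero] with μ h h0
    exact h.1 (h0.trans hbase.symm)
  obtain ⟨K, s, hs, hlip⟩ :=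
    (hstrict.hasStrictFDerivAt_implicitFunctionOfProdDomain hinv).exists_lipschitzOnWith
  have hproj : Tendsto (fun q : ℝ × ℝ => (q.1, (0 : ℝ))) (𝓝 (μ₀, 0)) (𝓝 (μ₀, 0)) :=
    (continuous_fst.prodMk continuous_const).tendsto' _ _ rfl
  have hPg : ∀ᶠ q in 𝓝 (μ₀, (0 : ℝ)), P (q, g q) :=
    (tendsto_id.prodMk_nhds hg).eventually hP
  refine ⟨K, ?_⟩
  filter_upwards [hsol, hPg, (continuous_fst.tendsto (μ₀, (0 : ℝ))).eventually huniq, hs,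
    hproj hs] with q hq hPq hu hqs hqs'
  refine ⟨g q, hq, hPq, ?_⟩
  have h := hlip.dist_le_mul q hqs (q.1, 0) hqs'
  rw [← hu, ← dist_eq_norm]
  refine h.trans_eq ?_
  rw [Prod.dist_eq]
  simp

/-- A local bound near each `(μ, 0)` becomes uniform over a compact set of `μ`. -/
theorem IsCompact.exists_uniform_of_eventually {s : Set ℝ} (hs : IsCompact s)
    {Q : ℝ → ℝ × ℝ → Prop} (hmono : ∀ C C' q, C ≤ C' → 0 < q.2 → Q C q → Q C' q)
    (h : ∀ μ ∈ s, ∃ C, ∀ᶠ q in 𝓝 (μ, (0 : ℝ)), 0 < q.2 → Q C q) :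
    ∃ δ > (0 : ℝ), ∃ C > (0 : ℝ), ∀ ε ∈ Ioo (0 : ℝ) δ, ∀ μ ∈ s, Q C (μ, ε) := by
  refine hs.induction_on (p := fun t => ∃ δ > (0 : ℝ), ∃ C > (0 : ℝ), ∀ ε ∈ Ioo (0 : ℝ) δ,
    ∀ μ ∈ t, Q C (μ, ε)) ⟨1, one_pos, 1, one_pos, by simp⟩ ?_ ?_ ?_
  · rintro t u htu ⟨δ, hδ, C, hC, H⟩
    exact ⟨δ, hδ, C, hC, fun ε hε μ hμ => H ε hε μ (htu hμ)⟩
  · rintro t u ⟨δ, hδ, C, hC, H⟩ ⟨δ', hδ', C', hC', H'⟩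
    refine ⟨min δ δ', lt_min hδ hδ', max C C', lt_max_of_lt_left hC, fun ε hε μ hμ => ?_⟩
    rcases hμ with hμ | hμ
    · exact hmono C _ _ (le_max_left _ _) hε.1
        (H ε ⟨hε.1, hε.2.trans_le (min_le_left _ _)⟩ μ hμ)
    · exact hmono C' _ _ (le_max_right _ _) hε.1
        (H' ε ⟨hε.1, hε.2.trans_le (min_le_right _ _)⟩ μ hμ)
  · intro μ hμ
    obtain ⟨C, hC⟩ := h μ hμ
    rw [nhds_prod_eq, eventually_prod_iff] at hC
    obtain ⟨pa, ha, pb, hb, H⟩ := hC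
    obtain ⟨δ, hδ, hball⟩ := Metric.eventually_nhds_iff.1 hb
    refine ⟨{μ | pa μ}, mem_nhdsWithin_of_mem_nhds ha, δ, hδ, max C 1,
      lt_max_of_lt_right one_pos, fun ε hε ν hν => ?_⟩
    refine hmono C _ _ (le_max_left _ _) hε.1 (H hν (hball ?_) hε.1)
    rw [Real.dist_eq, sub_zero, abs_of_pos hε.1]
    exact hε.2

theorem abs_arcsin_le_two_mul {y : ℝ} (hy : |y| ≤ 1) : |Real.arcsin y| ≤ 2 * |y| := by
  have key : ∀ x : ℝ, 0 ≤ x → x ≤ 1 → Real.arcsin x ≤ 2 * x := by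
    intro x hx hx1
    have h := Real.mul_le_sin (Real.arcsin_nonneg.2 hx) (Real.arcsin_le_pi_div_two x)
    rw [Real.sin_arcsin (by linarith) hx1, div_mul_eq_mul_div, div_le_iff₀ Real.pi_pos] at h
    nlinarith [Real.pi_le_four]
  rcases le_total 0 y with h | h
  · rw [abs_of_nonneg (Real.arcsin_nonneg.2 h)]
    rw [abs_of_nonneg h] at hy ⊢
    exact key y h hy
  · rw [abs_of_nonpos (Real.arcsin_nonpos.2 h), ← Real.arcsin_neg]
    rw [abs_of_nonpos h] at hy ⊢
    exact key (-y) (by linarith) hy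

/-- Parameters `(μ, ε)` together with rescaled amplitudes; the coordinate `0` is a dummy. -/
abbrev ScaledState (N : ℕ) := (ℝ × ℝ) × (Fin (N + 1) → ℝ)

namespace ScaledState

variable {N : ℕ}

/-- The rescaled amplitude at node `n` (indices are read modulo `N + 1`). -/
def coord (z : ScaledState N) (n : ℕ) : ℝ := z.2 (Fin.ofNat (N + 1) n)

/-- The amplitude `ε ^ (n - k) R_n` at node `n`. -/
def amp (k : ℕ) (z : ScaledState N) (n : ℕ) : ℝ := z.1.2 ^ (n - k) * z.coord n

/-- Weight of a node in the balance law: the centre of an on-site pattern counts half. -/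
def weight (onsite : Bool) (n : ℕ) : ℝ := if onsite = true ∧ n = 1 then 1 / 2 else 1

/-- Weighted mean of `ω₂`, i.e. the second-order frequency correction. -/
def meanFreq (k : ℕ) (onsite : Bool) (ω2 : ℝ → ℝ → ℝ → ℝ) (z : ScaledState N) : ℝ :=
  (∑ j ∈ Finset.Icc 1 N, weight onsite j * ω2 (z.amp k j) z.1.1 z.1.2 * z.amp k j ^ 2) /
    ∑ j ∈ Finset.Icc 1 N, weight onsite j * z.amp k j ^ 2

/-- Rescaled sum of the frequency imbalances of all nodes beyond `n`. -/
def tailSum (k : ℕ) (onsite : Bool) (ω2 : ℝ → ℝ → ℝ → ℝ) (n : ℕ) (z : ScaledState N) : ℝ :=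
  ∑ j ∈ Finset.Icc (n + 1) N, weight onsite j *
    (ω2 (z.amp k j) z.1.1 z.1.2 - z.meanFreq k onsite ω2) * z.coord j ^ 2 *
      z.1.2 ^ (2 * ((j - k) - (n + 1 - k)))

/-- The sine of the `n`-th phase difference divided by `ε`. -/
def sinRate (k : ℕ) (onsite : Bool) (ω2 : ℝ → ℝ → ℝ → ℝ) (n : ℕ) (z : ScaledState N) : ℝ :=
  z.1.2 ^ ((n + 1 - k) - (n - k)) * z.tailSum k onsite ω2 n / (z.coord n * z.coord (n + 1))

/-- The `n`-th phase difference as a function of the amplitudes. -/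
def phase (k : ℕ) (onsite : Bool) (ω2 : ℝ → ℝ → ℝ → ℝ) (z : ScaledState N) (n : ℕ) : ℝ :=
  Real.arcsin (z.1.2 * sinRate k onsite ω2 n z)

/-- The amplitude equations in rescaled variables, with the phase differences eliminated. -/
def residual (k : ℕ) (onsite : Bool) (lam : ℝ → ℝ → ℝ) (ω2 : ℝ → ℝ → ℝ → ℝ)
    (z : ScaledState N) (i : Fin (N + 1)) : ℝ :=
  if (i : ℕ) = 0 then z.coord i - 1
  else if (i : ℕ) ≤ k then
    lam (z.amp k i) z.1.1 * z.coord i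
      + z.1.2 * (extR N onsite (z.amp k) (i + 1)
            * Real.cos (extPhi N onsite (z.phase k onsite ω2) i)
          - 2 * z.coord i
          + extR N onsite (z.amp k) (i - 1)
            * Real.cos (extPhi N onsite (z.phase k onsite ω2) (i - 1)))
  else
    lam (z.amp k i) z.1.1 * z.coord i
      + z.1.2 * ((if (i : ℕ) = N then z.coord N else z.1.2 * z.coord (i + 1))
            * Real.cos (extPhi N onsite (z.phase k onsite ω2) i)
          - 2 * z.coord i)
      + z.coord (i - 1) * Real.cos (extPhi N onsite (z.phase k onsite ω2) (i - 1))

theorem contDiff_coord (n : ℕ) : ContDiff ℝ 1 (fun z : ScaledState N => z.coord n) := by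
  unfold coord; fun_prop

theorem contDiff_amp (k n : ℕ) : ContDiff ℝ 1 (fun z : ScaledState N => z.amp k n) := by
  have := contDiff_coord (N := N) n
  unfold amp; fun_prop

theorem weight_pos (onsite : Bool) (n : ℕ) : 0 < weight onsite n := by
  unfold weight; split_ifs <;> norm_num

theorem sum_weight_amp_sq_pos {k : ℕ} (onsite : Bool) (hk : 1 ≤ k) (hkN : k < N)
    {z : ScaledState N} (hz : ∀ n, 0 < z.coord n) :
    0 < ∑ j ∈ Finset.Icc 1 N, weight onsite j * z.amp k j ^ 2 := by
  refine Finset.sum_pos' (fun j _ => mul_nonneg (weight_pos _ _).le (sq_nonneg _))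
    ⟨1, by simp; omega, mul_pos (weight_pos _ _) (pow_pos ?_ 2)⟩
  simpa [amp, Nat.sub_eq_zero_of_le hk] using hz 1

variable {k : ℕ} {onsite : Bool} {lam : ℝ → ℝ → ℝ} {ω2 : ℝ → ℝ → ℝ → ℝ} {z : ScaledState N}

theorem contDiff_omega_amp (hω : ContDiff ℝ 1 (fun p : ℝ × ℝ × ℝ => ω2 p.1 p.2.1 p.2.2)) (n : ℕ) :
    ContDiff ℝ 1 (fun z : ScaledState N => ω2 (z.amp k n) z.1.1 z.1.2) :=
  hω.comp (g := fun p : ℝ × ℝ × ℝ => ω2 p.1 p.2.1 p.2.2)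
    (f := fun z : ScaledState N => (z.amp k n, z.1.1, z.1.2))
    ((contDiff_amp k n).prodMk (by fun_prop))

theorem contDiffAt_meanFreq (hω : ContDiff ℝ 1 (fun p : ℝ × ℝ × ℝ => ω2 p.1 p.2.1 p.2.2))
    (hk : 1 ≤ k) (hkN : k < N) (hz : ∀ n, 0 < z.coord n) :
    ContDiffAt ℝ 1 (meanFreq k onsite ω2) z := by
  have h1 := fun n => contDiff_omega_amp (N := N) (k := k) hω n
  have h2 := fun n => contDiff_amp (N := N) k n
  unfold meanFreq
  refine ContDiffAt.div (ContDiff.contDiffAt (ContDiff.sum fun j _ => ?_))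
    (ContDiff.contDiffAt (ContDiff.sum fun j _ => ?_))
    (sum_weight_amp_sq_pos onsite hk hkN hz).ne'
  · exact (contDiff_const.mul (h1 j)).mul ((h2 j).pow 2)
  · exact contDiff_const.mul ((h2 j).pow 2)

theorem contDiffAt_sinRate (hω : ContDiff ℝ 1 (fun p : ℝ × ℝ × ℝ => ω2 p.1 p.2.1 p.2.2))
    (hk : 1 ≤ k) (hkN : k < N) (hz : ∀ n, 0 < z.coord n) (n : ℕ) :
    ContDiffAt ℝ 1 (sinRate k onsite ω2 n) z := by
  have hε : ∀ m : ℕ, ContDiffAt ℝ 1 (fun z : ScaledState N => z.1.2 ^ m) z := fun m => by fun_prop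
  have hc : ∀ m, ContDiffAt ℝ 1 (fun z : ScaledState N => z.coord m) z :=
    fun m => (contDiff_coord m).contDiffAt
  unfold sinRate
  refine ContDiffAt.div ((hε _).mul ?_) ((hc _).mul (hc _)) (mul_pos (hz _) (hz _)).ne'
  unfold tailSum
  exact ContDiffAt.sum fun j _ => ((contDiffAt_const.mul
    ((contDiff_omega_amp hω j).contDiffAt.sub (contDiffAt_meanFreq hω hk hkN hz))).mul
      ((hc j).pow 2)).mul (hε _)

theorem contDiffAt_phase (hω : ContDiff ℝ 1 (fun p : ℝ × ℝ × ℝ => ω2 p.1 p.2.1 p.2.2))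
    (hk : 1 ≤ k) (hkN : k < N) (hz : ∀ n, 0 < z.coord n) (hε : z.1.2 = 0) (n : ℕ) :
    ContDiffAt ℝ 1 (fun z : ScaledState N => z.phase k onsite ω2 n) z := by
  unfold phase
  have hinner : ContDiffAt ℝ 1 (fun z : ScaledState N => z.1.2 * sinRate k onsite ω2 n z) z :=
    ContDiffAt.mul (by fun_prop) (contDiffAt_sinRate hω hk hkN hz n)
  exact ContDiffAt.comp (g := Real.arcsin) z
    (Real.contDiffAt_arcsin (by simp [hε]) (by simp [hε])) hinner

theorem contDiff_extR_amp (n : ℕ) :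
    ContDiff ℝ 1 (fun z : ScaledState N => extR N onsite (z.amp k) n) := by
  unfold extR
  split_ifs <;> exact contDiff_amp _ _

theorem contDiffAt_extPhi_phase (hω : ContDiff ℝ 1 (fun p : ℝ × ℝ × ℝ => ω2 p.1 p.2.1 p.2.2))
    (hk : 1 ≤ k) (hkN : k < N) (hz : ∀ n, 0 < z.coord n) (hε : z.1.2 = 0) (n : ℕ) :
    ContDiffAt ℝ 1 (fun z : ScaledState N => extPhi N onsite (z.phase k onsite ω2) n) z := by
  have h := fun n => contDiffAt_phase (onsite := onsite) hω hk hkN hz hε n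
  unfold extPhi
  split_ifs
  · exact (h 1).neg
  · exact contDiffAt_const
  · exact contDiffAt_const
  · exact h n

theorem contDiffAt_residual (hlam : ContDiff ℝ 1 (fun p : ℝ × ℝ => lam p.1 p.2))
    (hω : ContDiff ℝ 1 (fun p : ℝ × ℝ × ℝ => ω2 p.1 p.2.1 p.2.2))
    (hk : 1 ≤ k) (hkN : k < N) (hz : ∀ n, 0 < z.coord n) (hε : z.1.2 = 0) :
    ContDiffAt ℝ 1 (residual k onsite lam ω2) z := by
  have hc : ∀ m, ContDiffAt ℝ 1 (fun z : ScaledState N => z.coord m) z :=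
    fun m => (contDiff_coord m).contDiffAt
  have hr : ∀ m, ContDiffAt ℝ 1 (fun z : ScaledState N => extR N onsite (z.amp k) m) z :=
    fun m => (contDiff_extR_amp m).contDiffAt
  have hcos : ∀ m, ContDiffAt ℝ 1
      (fun z : ScaledState N => Real.cos (extPhi N onsite (z.phase k onsite ω2) m)) z :=
    fun m => (contDiffAt_extPhi_phase hω hk hkN hz hε m).cos
  have hl : ∀ m, ContDiffAt ℝ 1 (fun z : ScaledState N => lam (z.amp k m) z.1.1) z :=
    fun m => (hlam.comp (g := fun p : ℝ × ℝ => lam p.1 p.2)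
      (f := fun z : ScaledState N => (z.amp k m, z.1.1))
      ((contDiff_amp k m).prodMk (by fun_prop))).contDiffAt
  have he : ContDiffAt ℝ 1 (fun z : ScaledState N => z.1.2) z := by fun_prop
  rw [contDiffAt_pi]
  intro i
  unfold residual
  split_ifs
  · exact (hc _).sub contDiffAt_const
  · exact ((hl _).mul (hc _)).add (he.mul ((((hr _).mul (hcos _)).sub
      (contDiffAt_const.mul (hc _))).add ((hr _).mul (hcos _))))
  · exact (((hl _).mul (hc _)).add (he.mul (((hc _).mul (hcos _)).sub
      (contDiffAt_const.mul (hc _))))).add ((hc _).mul (hcos _))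
  · exact (((hl _).mul (hc _)).add (he.mul (((he.mul (hc _)).mul (hcos _)).sub
      (contDiffAt_const.mul (hc _))))).add ((hc _).mul (hcos _))

theorem coord_val (z : ScaledState N) (i : Fin (N + 1)) : z.coord i = z.2 i := by
  simp [coord]

theorem coord_of_lt (z : ScaledState N) {n : ℕ} (hn : n < N + 1) : z.coord n = z.2 ⟨n, hn⟩ :=
  z.coord_val ⟨n, hn⟩

theorem extPhi_phase_of_eps_eq_zero (hε : z.1.2 = 0) (n : ℕ) :
    extPhi N onsite (z.phase k onsite ω2) n = 0 := by
  simp [extPhi, phase, hε]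

theorem residual_of_eps_eq_zero (hε : z.1.2 = 0) (i : Fin (N + 1)) :
    residual k onsite lam ω2 z i =
      if (i : ℕ) = 0 then z.coord i - 1
      else if (i : ℕ) ≤ k then lam (z.coord i) z.1.1 * z.coord i
      else lam 0 z.1.1 * z.coord i + z.coord (i - 1) := by
  unfold residual
  simp only [extPhi_phase_of_eps_eq_zero hε]
  split_ifs with h0 hik
  · rfl
  · simp [hε, amp, Nat.sub_eq_zero_of_le hik]
  all_goals
    have : (i : ℕ) - k ≠ 0 := by omega
    simp [hε, amp, this]

/-- The scaled energy flux through the bond between nodes `n` and `n + 1`. -/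
def flux (k : ℕ) (onsite : Bool) (ω2 : ℝ → ℝ → ℝ → ℝ) (z : ScaledState N) (n : ℕ) : ℝ :=
  z.1.2 * ∑ j ∈ Finset.Icc (n + 1) N, weight onsite j *
    (ω2 (z.amp k j) z.1.1 z.1.2 - z.meanFreq k onsite ω2) * z.amp k j ^ 2

theorem flux_sub_one {n : ℕ} (hn : 1 ≤ n) (hnN : n ≤ N) :
    z.flux k onsite ω2 (n - 1) = z.flux k onsite ω2 n + z.1.2 * (weight onsite n *
      (ω2 (z.amp k n) z.1.1 z.1.2 - z.meanFreq k onsite ω2) * z.amp k n ^ 2) := by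
  unfold flux
  rw [Nat.sub_add_cancel hn, ← Finset.add_sum_Ioc_eq_sum_Icc hnN, ← Finset.Icc_add_one_left_eq_Ioc]
  ring

theorem flux_zero (hk : 1 ≤ k) (hkN : k < N) (hz : ∀ n, 0 < z.coord n) :
    z.flux k onsite ω2 0 = 0 := by
  have hpos := (sum_weight_amp_sq_pos onsite hk hkN hz).ne'
  unfold flux meanFreq
  simp only [zero_add, mul_sub, sub_mul, Finset.sum_sub_distrib]
  rw [sub_eq_zero]
  congr 1
  simp_rw [mul_right_comm _ (_ / _), ← Finset.sum_mul]
  rw [mul_div_cancel₀ _ hpos]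

theorem flux_last : z.flux k onsite ω2 N = 0 := by
  simp [flux]

theorem amp_mul_amp_mul_sin_phase (hz : ∀ n, 0 < z.coord n) {n : ℕ}
    (hs : |z.1.2 * sinRate k onsite ω2 n z| ≤ 1) :
    z.amp k n * z.amp k (n + 1) * Real.sin (z.phase k onsite ω2 n) = z.flux k onsite ω2 n := by
  have h1 := (hz n).ne'
  have h2 := (hz (n + 1)).ne'
  have htail : z.1.2 ^ (2 * (n + 1 - k)) * z.tailSum k onsite ω2 n =
      ∑ j ∈ Finset.Icc (n + 1) N, weight onsite j *
        (ω2 (z.amp k j) z.1.1 z.1.2 - z.meanFreq k onsite ω2) * z.amp k j ^ 2 := by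
    unfold tailSum
    rw [Finset.mul_sum]
    refine Finset.sum_congr rfl fun j hj => ?_
    have hj' := (Finset.mem_Icc.1 hj).1
    have he : z.1.2 ^ (2 * (n + 1 - k)) * z.1.2 ^ (2 * ((j - k) - (n + 1 - k))) =
        (z.1.2 ^ (j - k)) ^ 2 := by
      rw [← pow_add, ← pow_mul]
      congr 1
      omega
    calc _ = weight onsite j * (ω2 (z.amp k j) z.1.1 z.1.2 - z.meanFreq k onsite ω2) *
          z.coord j ^ 2 * (z.1.2 ^ (2 * (n + 1 - k)) *
            z.1.2 ^ (2 * ((j - k) - (n + 1 - k)))) := by ring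
      _ = _ := by rw [he, amp]; ring
  have he : z.1.2 ^ (n - k) * z.1.2 ^ (n + 1 - k) * z.1.2 ^ ((n + 1 - k) - (n - k)) =
      z.1.2 ^ (2 * (n + 1 - k)) := by
    rw [← pow_add, ← pow_add]
    congr 1
    omega
  rw [phase, Real.sin_arcsin (abs_le.1 hs).1 (abs_le.1 hs).2, flux, ← htail, ← he, sinRate, amp,
    amp]
  field_simp

theorem extR_of_mem {r : ℕ → ℝ} {n : ℕ} (hn : 1 ≤ n) (hnN : n ≤ N) : extR N onsite r n = r n := by
  rw [extR, if_neg (by omega), if_neg (by omega)]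

theorem extPhi_of_mem {φ : ℕ → ℝ} {n : ℕ} (hn : 1 ≤ n) (hnN : n < N) :
    extPhi N onsite φ n = φ n := by
  rw [extPhi, if_neg (by omega), if_neg (by omega)]

theorem amp_mul_next (hz : ∀ n, 0 < z.coord n)
    (hs : ∀ n ≤ N, |z.1.2 * sinRate k onsite ω2 n z| ≤ 1) {n : ℕ} (hn : 1 ≤ n) (hnN : n ≤ N) :
    z.amp k n * (extR N onsite (z.amp k) (n + 1) *
      Real.sin (extPhi N onsite (z.phase k onsite ω2) n)) = z.flux k onsite ω2 n := by
  rcases hnN.eq_or_lt with rfl | hlt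
  · rw [flux_last]
    simp [extPhi, show n ≠ 0 by omega]
  · rw [extR_of_mem (by omega) hlt, extPhi_of_mem hn hlt, ← mul_assoc,
      amp_mul_amp_mul_sin_phase hz (hs n hnN)]

theorem phase_equation (hk : 1 ≤ k) (hkN : k < N) (hz : ∀ n, 0 < z.coord n)
    (hε : 0 < z.1.2) (hs : ∀ n ≤ N, |z.1.2 * sinRate k onsite ω2 n z| ≤ 1)
    {n : ℕ} (hn : 1 ≤ n) (hnN : n ≤ N) :
    z.1.2 ^ 2 * (ω2 (z.amp k n) z.1.1 z.1.2 - z.meanFreq k onsite ω2) * z.amp k n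
      + z.1.2 * (extR N onsite (z.amp k) (n + 1) *
            Real.sin (extPhi N onsite (z.phase k onsite ω2) n)
          - extR N onsite (z.amp k) (n - 1) *
            Real.sin (extPhi N onsite (z.phase k onsite ω2) (n - 1))) = 0 := by
  have hamp : z.amp k n ≠ 0 := (mul_pos (pow_pos hε _) (hz n)).ne'
  have hnext := amp_mul_next hz hs hn hnN
  have hflux := flux_sub_one (k := k) (onsite := onsite) (ω2 := ω2) (z := z) hn hnN
  refine (mul_eq_zero.1 (?_ : z.amp k n * _ = 0)).resolve_left hamp
  rcases hn.eq_or_lt with rfl | hlt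
  · rw [Nat.sub_self, flux_zero hk hkN hz] at hflux
    cases onsite
    · simp only [weight, Bool.false_eq_true, false_and, if_false] at hflux
      simp only [extPhi, Nat.sub_self, if_true, Bool.false_eq_true, if_false,
        Real.sin_zero] at hnext ⊢
      linear_combination z.1.2 * hnext - z.1.2 * hflux
    · simp only [weight, true_and, if_true] at hflux
      have h1N : 1 < N := by omega
      rw [extR_of_mem (by omega) (by omega), extPhi_of_mem le_rfl h1N] at hnext ⊢
      simp only [extR, extPhi, Nat.sub_self, if_true, Real.sin_neg]
      linear_combination 2 * z.1.2 * hnext - 2 * z.1.2 * hflux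
  · have hprev := amp_mul_amp_mul_sin_phase hz (hs (n - 1) (by omega))
    rw [Nat.sub_add_cancel hn] at hprev
    rw [extR_of_mem (n := n - 1) (by omega) (by omega),
      extPhi_of_mem (n := n - 1) (by omega) (by omega)]
    have hw : weight onsite n = 1 := by
      rw [weight, if_neg]
      omega
    rw [hw] at hflux
    linear_combination z.1.2 * hnext - z.1.2 * hprev - z.1.2 * hflux

theorem amplitude_equation (hk : 1 ≤ k) (hres : residual k onsite lam ω2 z = 0)
    {n : ℕ} (hn : 1 ≤ n) (hnN : n ≤ N) :
    lam (z.amp k n) z.1.1 * z.amp k n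
      + z.1.2 * (extR N onsite (z.amp k) (n + 1) *
            Real.cos (extPhi N onsite (z.phase k onsite ω2) n)
          - 2 * z.amp k n
          + extR N onsite (z.amp k) (n - 1) *
            Real.cos (extPhi N onsite (z.phase k onsite ω2) (n - 1))) = 0 := by
  have h := congrFun hres ⟨n, by omega⟩
  simp only [residual, Pi.zero_apply] at h
  rw [if_neg (by omega)] at h
  by_cases hnk : n ≤ k
  · rw [if_pos hnk] at h
    have : z.amp k n = z.coord n := by simp [amp, Nat.sub_eq_zero_of_le hnk]
    rw [← this] at h
    exact h
  · rw [if_neg hnk] at h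
    have hprev : z.1.2 * extR N onsite (z.amp k) (n - 1) = z.1.2 ^ (n - k) * z.coord (n - 1) := by
      rw [extR_of_mem (by omega) (by omega), amp, ← mul_assoc, ← pow_succ']
      congr 2
      omega
    have hnext : extR N onsite (z.amp k) (n + 1) = z.1.2 ^ (n - k) *
        (if n = N then z.coord N else z.1.2 * z.coord (n + 1)) := by
      split_ifs with hN
      · subst hN
        simp [extR, amp]
      · rw [extR_of_mem (by omega) (by omega), amp, ← mul_assoc, ← pow_succ]
        congr 2
        omega
    rw [hnext]
    have hamp : z.amp k n = z.1.2 ^ (n - k) * z.coord n := rfl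
    linear_combination z.1.2 ^ (n - k) * h + (lam (z.amp k n) z.1.1 - 2 * z.1.2) * hamp
      + Real.cos (extPhi N onsite (z.phase k onsite ω2) (n - 1)) * hprev

theorem dissipSol_of_residual_eq_zero {om : ℝ → ℝ → ℝ → ℝ} {ω0 : ℝ → ℝ}
    (hom : ∀ r μ ε, om r μ ε = ω0 μ + ε ^ 2 * ω2 r μ ε)
    (hk : 1 ≤ k) (hkN : k < N) (hz : ∀ n, 0 < z.coord n) (hε : 0 < z.1.2)
    (hs : ∀ n ≤ N, |z.1.2 * sinRate k onsite ω2 n z| ≤ 1)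
    (hres : residual k onsite lam ω2 z = 0) :
    DissipSol N onsite lam om z.1.1 z.1.2 (z.amp k) (z.phase k onsite ω2)
      (ω0 z.1.1 + z.1.2 ^ 2 * z.meanFreq k onsite ω2) := by
  intro n hn hnN
  rw [extR_of_mem hn hnN, hom]
  refine ⟨amplitude_equation hk hres hn hnN, ?_⟩
  linear_combination phase_equation hk hkN hz hε hs hn hnN

end ScaledState

/-- The prescribed amplitude at a core node; the dummy node `0` carries the value `1`. -/
def coreAmp (rm rp : ℝ → ℝ) (p : ℕ → Bool) (μ : ℝ) (n : ℕ) : ℝ :=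
  if n = 0 then 1 else if p n then rp μ else rm μ

/-- The rescaled pattern at `ε = 0`: the prescribed core, continued geometrically. -/
def basePattern (N k : ℕ) (lam : ℝ → ℝ → ℝ) (rm rp : ℝ → ℝ) (p : ℕ → Bool) (μ : ℝ)
    (i : Fin (N + 1)) : ℝ :=
  coreAmp rm rp p μ (min i k) * (-(lam 0 μ))⁻¹ ^ ((i : ℕ) - k)

namespace Hyp1

variable {lam : ℝ → ℝ → ℝ} {rm rp : ℝ → ℝ} {p : ℕ → Bool} {μ : ℝ}

theorem hasDerivAt_lam (h : Hyp1 lam rm rp) (r μ : ℝ) :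
    HasDerivAt (fun r => lam r μ) (deriv (fun r => lam r μ) r) r := by
  have hd : Differentiable ℝ (fun q : ℝ × ℝ => lam q.1 q.2) :=
    (h.smooth 1).differentiable (by simp)
  exact ((hd (r, μ)).comp (f := fun r : ℝ => (r, μ)) r (by fun_prop)).hasDerivAt

theorem coreAmp_pos (h : Hyp1 lam rm rp) (hμ : μ ∈ Ioo (0 : ℝ) 1) (n : ℕ) :
    0 < coreAmp rm rp p μ n := by
  have h1 := h.rm_pos μ hμ
  have h2 := h.rm_lt_rp μ hμ
  unfold coreAmp
  split_ifs <;> linarith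

theorem lam_coreAmp (h : Hyp1 lam rm rp) (hμ : μ ∈ Ioo (0 : ℝ) 1) {n : ℕ} (hn : n ≠ 0) :
    lam (coreAmp rm rp p μ n) μ = 0 := by
  refine (h.roots μ hμ _ (h.coreAmp_pos hμ n)).2 ?_
  rw [coreAmp, if_neg hn]
  split_ifs <;> simp

theorem deriv_lam_coreAmp_ne_zero (h : Hyp1 lam rm rp) (hμ : μ ∈ Ioo (0 : ℝ) 1) {n : ℕ}
    (hn : n ≠ 0) : deriv (fun r => lam r μ) (coreAmp rm rp p μ n) ≠ 0 := by
  rw [coreAmp, if_neg hn]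
  split_ifs
  · exact (h.stab_p μ hμ).ne
  · exact (h.stab_m μ hμ).ne'

theorem continuousAt_coreAmp (h : Hyp1 lam rm rp) (hμ : μ ∈ Ioo (0 : ℝ) 1) (n : ℕ) :
    ContinuousAt (fun μ => coreAmp rm rp p μ n) μ := by
  have hnhds := Ioo_mem_nhds hμ.1 hμ.2
  unfold coreAmp
  split_ifs
  · exact continuousAt_const
  · exact h.rp_cont.continuousAt hnhds
  · exact h.rm_cont.continuousAt hnhds

variable {N k : ℕ}

theorem basePattern_pos (h : Hyp1 lam rm rp) (hμ : μ ∈ Ioo (0 : ℝ) 1) (i : Fin (N + 1)) :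
    0 < basePattern N k lam rm rp p μ i :=
  mul_pos (h.coreAmp_pos hμ _) (pow_pos (inv_pos.2 (neg_pos.2 (h.lam0_neg μ hμ))) _)

theorem continuousAt_basePattern (h : Hyp1 lam rm rp) (hμ : μ ∈ Ioo (0 : ℝ) 1) :
    ContinuousAt (basePattern N k lam rm rp p) μ := by
  rw [continuousAt_pi]
  intro i
  have hlam : Continuous (fun μ => lam 0 μ) :=
    (h.smooth 1).continuous.comp (f := fun μ : ℝ => ((0 : ℝ), μ)) (by fun_prop)
  exact (h.continuousAt_coreAmp hμ _).mul
    ((hlam.continuousAt.neg.inv₀ (neg_pos.2 (h.lam0_neg μ hμ)).ne').pow _)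

theorem basePattern_of_le {i : Fin (N + 1)} (hi : (i : ℕ) ≤ k) :
    basePattern N k lam rm rp p μ i = coreAmp rm rp p μ i := by
  simp [basePattern, hi]

theorem residual_basePattern (h : Hyp1 lam rm rp) (hμ : μ ∈ Ioo (0 : ℝ) 1) (onsite : Bool)
    (ω2 : ℝ → ℝ → ℝ → ℝ) :
    ScaledState.residual k onsite lam ω2 ((μ, 0), basePattern N k lam rm rp p μ) = 0 := by
  funext i
  rw [ScaledState.residual_of_eps_eq_zero rfl, ScaledState.coord_val]
  split_ifs with h0 hik
  · simp [basePattern_of_le (show (i : ℕ) ≤ k by omega), coreAmp, h0]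
  · simp [basePattern_of_le hik, h.lam_coreAmp hμ h0]
  · have hlam := (h.lam0_neg μ hμ).ne
    rw [ScaledState.coord_of_lt _ (show (i : ℕ) - 1 < N + 1 by omega)]
    have hexp : (i : ℕ) - k = (i - 1 - k) + 1 := by omega
    simp only [basePattern, min_eq_right (show k ≤ (i : ℕ) by omega),
      min_eq_right (show k ≤ (i : ℕ) - 1 by omega), hexp, pow_succ, Pi.zero_apply]
    field_simp
    ring

theorem residual_deriv_injective (h : Hyp1 lam rm rp) (hμ : μ ∈ Ioo (0 : ℝ) 1) (onsite : Bool)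
    (ω2 : ℝ → ℝ → ℝ → ℝ) (v : Fin (N + 1) → ℝ)
    (hv : HasDerivAt (fun t : ℝ => ScaledState.residual k onsite lam ω2
      ((μ, 0), basePattern N k lam rm rp p μ + t • v)) 0 0) : v = 0 := by
  rw [hasDerivAt_pi] at hv
  have hline : ∀ i, HasDerivAt (fun t : ℝ => basePattern N k lam rm rp p μ i + t * v i) (v i) 0 := by
    intro i
    simpa using ((hasDerivAt_id' (0 : ℝ)).mul_const (v i)).const_add
      (basePattern N k lam rm rp p μ i)
  have hcoord : ∀ {n : ℕ} (hn : n < N + 1) (t : ℝ),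
      ScaledState.coord ((μ, 0), basePattern N k lam rm rp p μ + t • v) n =
        basePattern N k lam rm rp p μ ⟨n, hn⟩ + t * v ⟨n, hn⟩ :=
    fun hn t => ScaledState.coord_of_lt _ hn
  have key : ∀ n : ℕ, ∀ hn : n < N + 1, v ⟨n, hn⟩ = 0 := by
    intro n
    induction n with
    | zero =>
      intro hn
      have hd := hv ⟨0, hn⟩
      simp only [ScaledState.residual_of_eps_eq_zero, hcoord hn, if_true] at hd
      exact ((hline _).sub_const 1).unique hd
    | succ n ih =>
      intro hn
      have hd := hv ⟨n + 1, hn⟩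
      simp only [ScaledState.residual_of_eps_eq_zero, hcoord hn, Nat.succ_ne_zero,
        if_false] at hd
      by_cases hnk : n + 1 ≤ k
      · simp only [hnk, if_true] at hd
        have hbase : basePattern N k lam rm rp p μ ⟨n + 1, hn⟩ = coreAmp rm rp p μ (n + 1) :=
          basePattern_of_le hnk
        have hcomp := HasDerivAt.comp (h₂ := fun r => lam r μ) (0 : ℝ)
          (h.hasDerivAt_lam (basePattern N k lam rm rp p μ ⟨n + 1, hn⟩ + 0 * v ⟨n + 1, hn⟩) μ)
          (hline ⟨n + 1, hn⟩)
        have h0 := (hcomp.mul (hline ⟨n + 1, hn⟩)).unique hd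
        simp only [Function.comp, zero_mul, add_zero, hbase,
          h.lam_coreAmp hμ (Nat.succ_ne_zero n)] at h0
        simpa [h.deriv_lam_coreAmp_ne_zero hμ (Nat.succ_ne_zero n),
          (h.coreAmp_pos hμ (n + 1)).ne'] using h0
      · simp only [hnk, if_false, Nat.add_sub_cancel, hcoord (show n < N + 1 by omega)] at hd
        have h0 := (((hline ⟨n + 1, hn⟩).const_mul (lam 0 μ)).add (hline ⟨n, by omega⟩)).unique hd
        rw [ih (by omega), add_zero] at h0
        exact (mul_eq_zero.1 h0).resolve_left (h.lam0_neg μ hμ).ne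
  funext i
  exact key i i.2

end Hyp1

/-- At parameters `q = (μ, ε)` there is a solution following the pattern `p` up to the stated
error bounds with constant `C`. -/
def HasPatternSol (N k : ℕ) (onsite : Bool) (lam : ℝ → ℝ → ℝ) (om : ℝ → ℝ → ℝ → ℝ)
    (rm rp ω0 : ℝ → ℝ) (p : ℕ → Bool) (C : ℝ) (q : ℝ × ℝ) : Prop :=
  ∃ r φ : ℕ → ℝ, ∃ ρ : ℝ,
    DissipSol N onsite lam om q.1 q.2 r φ ρ ∧
    (∀ n, 1 ≤ n → n ≤ k → |r n - (if p n then rp q.1 else rm q.1)| ≤ C * q.2) ∧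
    (∀ n, k + 1 ≤ n → n ≤ N → |r n| ≤ C * q.2 ^ (n - k)) ∧
    (∀ n, 1 ≤ n → n ≤ N - 1 → |φ n| ≤ C * q.2) ∧
    |ρ - ω0 q.1| ≤ C * q.2

theorem HasPatternSol.mono {N k : ℕ} {onsite : Bool} {lam : ℝ → ℝ → ℝ} {om : ℝ → ℝ → ℝ → ℝ}
    {rm rp ω0 : ℝ → ℝ} {p : ℕ → Bool} {C C' : ℝ} {q : ℝ × ℝ} (hCC : C ≤ C') (hq : 0 < q.2)
    (h : HasPatternSol N k onsite lam om rm rp ω0 p C q) :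
    HasPatternSol N k onsite lam om rm rp ω0 p C' q := by
  obtain ⟨r, φ, ρ, hsol, hcore, hfar, hphase, hfreq⟩ := h
  have hmono1 : C * q.2 ≤ C' * q.2 := mul_le_mul_of_nonneg_right hCC hq.le
  exact ⟨r, φ, ρ, hsol, fun n hn hn' => (hcore n hn hn').trans hmono1,
    fun n hn hn' => (hfar n hn hn').trans (mul_le_mul_of_nonneg_right hCC (pow_pos hq _).le),
    fun n hn hn' => (hphase n hn hn').trans hmono1, hfreq.trans hmono1⟩

/-- Local version of the persistence theorem, near `ε = 0` and a fixed `μ₀`. -/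
theorem eventually_exists_patternSol {N k : ℕ} (hk1 : 1 ≤ k) (hkN : k < N)
    {lam : ℝ → ℝ → ℝ} {om ω2 : ℝ → ℝ → ℝ → ℝ} {rm rp ω0 : ℝ → ℝ}
    (h1 : Hyp1 lam rm rp) (h2 : Hyp2 om ω0 ω2) (p : ℕ → Bool) (onsite : Bool)
    {μ₀ : ℝ} (hμ₀ : μ₀ ∈ Ioo (0 : ℝ) 1) :
    ∃ C, ∀ᶠ q : ℝ × ℝ in 𝓝 (μ₀, (0 : ℝ)), 0 < q.2 →
      HasPatternSol N k onsite lam om rm rp ω0 p C q := by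
  obtain ⟨-, hω, hom⟩ := h2
  set x₀ := basePattern N k lam rm rp p
  set z₀ : ScaledState N := ((μ₀, 0), x₀ μ₀)
  have hz₀ : ∀ n, 0 < z₀.coord n := fun n => h1.basePattern_pos hμ₀ _
  set H : ScaledState N → ℝ := fun z => |z.meanFreq k onsite ω2| +
    ∑ n ∈ Finset.range (N + 1), (|z.sinRate k onsite ω2 n| + |z.coord n|)
  have hH : ContinuousAt H z₀ :=
    (ScaledState.contDiffAt_meanFreq (hω 1) hk1 hkN hz₀).continuousAt.abs.add
      (tendsto_finsetSum _ fun n _ =>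
        (ScaledState.contDiffAt_sinRate (hω 1) hk1 hkN hz₀ n).continuousAt.abs.add
          (ScaledState.contDiff_coord n).continuous.continuousAt.abs)
  set B := H z₀ + 1
  have hB : ∀ᶠ z in 𝓝 z₀, H z < B := hH.eventually_lt_const (lt_add_one _)
  have hpos : ∀ᶠ z : ScaledState N in 𝓝 z₀, ∀ i, 0 < z.2 i :=
    eventually_all.2 fun i =>
      (by fun_prop : ContinuousAt (fun z : ScaledState N => z.2 i) z₀).eventually_const_lt
        (h1.basePattern_pos hμ₀ i)
  obtain ⟨K, hK⟩ := exists_perturbed_zero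
    (ScaledState.contDiffAt_residual (onsite := onsite) (h1.smooth 1) (hω 1) hk1 hkN hz₀ rfl)
    (h1.continuousAt_basePattern hμ₀)
    (by filter_upwards [Ioo_mem_nhds hμ₀.1 hμ₀.2] with μ hμ using
      h1.residual_basePattern hμ onsite ω2)
    (h1.residual_deriv_injective hμ₀ onsite ω2) (hB.and hpos)
  have hsmall : ∀ᶠ q : ℝ × ℝ in 𝓝 (μ₀, (0 : ℝ)), q.2 * B < 1 ∧ q.2 < 1 :=
    ((by fun_prop : Continuous fun q : ℝ × ℝ => q.2 * B).tendsto _ |>.eventually_lt_const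
      (by simp)).and ((continuous_snd.tendsto _).eventually_lt_const (by simp))
  refine ⟨max K (2 * B), ?_⟩
  filter_upwards [hK, hsmall] with q hq ⟨hqB, hq1⟩ hqpos
  obtain ⟨x, hres, ⟨hHB, hxpos⟩, hdist⟩ := hq
  set z : ScaledState N := (q, x)
  have hterm : ∀ n ≤ N, |z.sinRate k onsite ω2 n| + |z.coord n| ≤ H z := by
    intro n hn
    refine (Finset.single_le_sum
      (f := fun n => |z.sinRate k onsite ω2 n| + |z.coord n|)
      (fun _ _ => by positivity) (Finset.mem_range.2 (Nat.lt_succ_of_le hn))).trans ?_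
    exact le_add_of_nonneg_left (abs_nonneg _)
  have hmean : |z.meanFreq k onsite ω2| ≤ B :=
    (le_add_of_nonneg_right (Finset.sum_nonneg fun _ _ => by positivity)).trans hHB.le
  have hsin : ∀ n ≤ N, |z.sinRate k onsite ω2 n| ≤ B := fun n hn =>
    (le_add_of_nonneg_right (abs_nonneg _)).trans ((hterm n hn).trans hHB.le)
  have hcoord : ∀ n ≤ N, |z.coord n| ≤ B := fun n hn =>
    (le_add_of_nonneg_left (abs_nonneg _)).trans ((hterm n hn).trans hHB.le)
  have hB0 : 0 ≤ B := (abs_nonneg _).trans hmean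
  have hsinε : ∀ n ≤ N, |q.2 * z.sinRate k onsite ω2 n| ≤ q.2 * B := by
    intro n hn
    rw [abs_mul, abs_of_pos hqpos]
    exact mul_le_mul_of_nonneg_left (hsin n hn) hqpos.le
  have hBC : 2 * B ≤ max K (2 * B) := le_max_right _ _
  refine ⟨z.amp k, z.phase k onsite ω2, _, ScaledState.dissipSol_of_residual_eq_zero hom hk1 hkN
    (z := z) (fun n => hxpos (Fin.ofNat (N + 1) n)) hqpos
    (fun n hn => (hsinε n hn).trans hqB.le) hres, ?_, ?_, ?_, ?_⟩
  · intro n hn hnk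
    have hcore : x₀ q.1 ⟨n, by omega⟩ = if p n then rp q.1 else rm q.1 := by
      rw [show x₀ q.1 ⟨n, _⟩ = _ from Hyp1.basePattern_of_le (i := ⟨n, by omega⟩) hnk, coreAmp,
        if_neg (by simp; omega)]
    have hamp : z.amp k n = x ⟨n, by omega⟩ := by
      rw [ScaledState.amp, Nat.sub_eq_zero_of_le hnk, pow_zero, one_mul,
        ScaledState.coord_of_lt z (show n < N + 1 by omega)]
    rw [hamp, ← hcore]
    have h := (norm_le_pi_norm (x - x₀ q.1) ⟨n, by omega⟩).trans hdist
    rw [abs_of_pos hqpos] at h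
    exact h.trans (mul_le_mul_of_nonneg_right (le_max_left _ _) hqpos.le)
  · intro n _ hnN
    rw [ScaledState.amp, abs_mul, abs_of_pos (pow_pos hqpos _), mul_comm]
    exact mul_le_mul_of_nonneg_right (by linarith [hcoord n hnN]) (pow_pos hqpos _).le
  · intro n _ hnN
    have hn := hsinε n (by omega)
    have h := abs_arcsin_le_two_mul (hn.trans hqB.le)
    refine h.trans ?_
    nlinarith
  · rw [add_sub_cancel_left, abs_mul, abs_of_pos (pow_pos hqpos 2)]
    have hsq : q.2 ^ 2 ≤ q.2 := by nlinarith
    calc q.2 ^ 2 * |z.meanFreq k onsite ω2| ≤ q.2 * B := by gcongr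
      _ ≤ max K (2 * B) * q.2 := by nlinarith

/-- Persistence of localized synchrony patterns in the bistability region:
for every compact interval `[a, b] ⊂ (0, 1)` and every core pattern
`p : {1,…,k} → {−,+}` (`p n = true` meaning `r₊`, `p n = false` meaning `r₋`),
for all sufficiently small `ε > 0` there are off-site and on-site solutions whose
first `k` nodes are `O(ε)`-close to the prescribed pattern, whose far-field nodes
decay like `ε^{n−k}`, whose phase differences are `O(ε)`, and whose frequency is
`O(ε)`-close to `ω₀(μ)`. -/
theorem persistence_bistability (N k : ℕ) (hN : 2 ≤ N) (hk1 : 1 ≤ k) (hkN : k < N)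
    (lam : ℝ → ℝ → ℝ) (om ω2 : ℝ → ℝ → ℝ → ℝ) (rm rp ω0 : ℝ → ℝ)
    (h1 : Hyp1 lam rm rp) (h2 : Hyp2 om ω0 ω2)
    (a b : ℝ) (ha : 0 < a) (hab : a ≤ b) (hb : b < 1)
    (p : ℕ → Bool) :
    ∃ εstar > (0:ℝ), ∃ C > (0:ℝ), ∀ ε ∈ Ioo (0:ℝ) εstar, ∀ μ ∈ Icc a b,
      ∀ onsite : Bool, ∃ r φ : ℕ → ℝ, ∃ ρ : ℝ,
        DissipSol N onsite lam om μ ε r φ ρ ∧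
        (∀ n, 1 ≤ n → n ≤ k → |r n - (if p n then rp μ else rm μ)| ≤ C * ε) ∧
        (∀ n, k + 1 ≤ n → n ≤ N → |r n| ≤ C * ε ^ (n - k)) ∧
        (∀ n, 1 ≤ n → n ≤ N - 1 → |φ n| ≤ C * ε) ∧
        |ρ - ω0 μ| ≤ C * ε := by
  refine isCompact_Icc.exists_uniform_of_eventually (Q := fun C q => ∀ onsite : Bool,
    HasPatternSol N k onsite lam om rm rp ω0 p C q) ?_ ?_
  · exact fun C C' q hCC hq hQ onsite => (hQ onsite).mono hCC hq
  · intro μ hμ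
    have hμ' : μ ∈ Ioo (0 : ℝ) 1 := ⟨ha.trans_le hμ.1, hμ.2.trans_lt hb⟩
    choose C hC using fun onsite : Bool => eventually_exists_patternSol hk1 hkN h1 h2 p onsite hμ'
    refine ⟨max (C true) (C false), ?_⟩
    filter_upwards [eventually_all.2 hC] with q hq hpos onsite
    exact (hq onsite hpos).mono (by cases onsite <;> simp) hpos
end
end

section
/- Determinant of the off-site core phase Jacobian: Let k ≥ 2 and r_1, …, r_k ∈ ℝ. Let A be the k × k real matrix with entries A_{n,1} = r_n for 1 ≤ n ≤ k, A_{n,n+1} = r_{n+1} for 1 ≤ n ≤ k−1, A_{n,n} = −r_{n−1} for 2 ≤ n ≤ k, and all other entries zero. Then det A = (−1)^{k+1} (∏_{n=2}^{k−1} r_n) (∑_{n=1}^{k} r_n²) (the product being 1 when k = 2). In particular, A is invertible whenever r_n ≠ 0 for all 2 ≤ n ≤ k−1 and (r_1, …, r_k) ≠ 0. -/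
noncomputable section

/-- The off-site core phase Jacobian: rows/columns are 0-indexed, so row `i`
is the paper's row `n = i + 1` and column `j` is the paper's column `j + 1`
(column `1` is the `Ω`-column). -/
def offsiteA (k : ℕ) (r : ℕ → ℝ) : Matrix (Fin k) (Fin k) ℝ :=
  Matrix.of fun i j =>
    if (j : ℕ) = 0 then r ((i : ℕ) + 1)
    else if (j : ℕ) = (i : ℕ) + 1 then r ((i : ℕ) + 2)
    else if (j : ℕ) = (i : ℕ) then -r (i : ℕ)
    else 0

/-- Deleting the last row and column of `offsiteA (m + 1) r` leaves `offsiteA m r`. -/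
lemma offsiteA_submatrix_castSucc (m : ℕ) (r : ℕ → ℝ) :
    (offsiteA (m + 1) r).submatrix Fin.castSucc Fin.castSucc = offsiteA m r := by
  ext i j
  rfl

/-- Deleting the last row and the `Ω`-column leaves a lower triangular matrix. -/
lemma det_offsiteA_submatrix_castSucc_succ (m : ℕ) (r : ℕ → ℝ) :
    ((offsiteA (m + 1) r).submatrix Fin.castSucc Fin.succ).det =
      ∏ i ∈ Finset.range m, r (i + 2) := by
  rw [Matrix.det_of_isLowerTriangular, ← Fin.prod_univ_eq_prod_range (fun i => r (i + 2))]
  · simp [offsiteA]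
  · intro i j hij
    have hlt : (i : ℕ) < j := hij
    have h₁ : (j : ℕ) ≠ i := by omega
    have h₂ : (j : ℕ) + 1 ≠ i := by omega
    simp [offsiteA, h₁, h₂]

/-- Laplace expansion along the last row. -/
lemma det_offsiteA_succ (m : ℕ) (hm : 1 ≤ m) (r : ℕ → ℝ) :
    (offsiteA (m + 1) r).det =
      (-1) ^ m * r (m + 1) * ∏ i ∈ Finset.range m, r (i + 2) - r m * (offsiteA m r).det := by
  have hm₀ : m ≠ 0 := by omega
  rw [Matrix.det_succ_row _ (Fin.last m), Fintype.sum_eq_add 0 (Fin.last m)]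
  · have h_succ : (Fin.succAbove (0 : Fin (m + 1))) = Fin.succ := by
      ext; simp
    have h_last : (Fin.succAbove (Fin.last m)) = Fin.castSucc := by
      ext; simp
    rw [h_succ, h_last, offsiteA_submatrix_castSucc, det_offsiteA_submatrix_castSucc_succ]
    simp [offsiteA, hm₀, ← two_mul, pow_mul, sub_eq_add_neg]
  · simp [Fin.ext_iff, hm₀.symm]
  · rintro j ⟨hj₀, hj⟩
    have h₀ : (j : ℕ) ≠ 0 := fun h => hj₀ (Fin.ext h)
    have h₁ : (j : ℕ) ≠ m := fun h => hj (Fin.ext h)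
    have h₂ : (j : ℕ) ≠ m + 1 := j.isLt.ne
    simp [offsiteA, hj₀, h₁, h₂]

lemma prod_Icc_two_eq_prod_range (m : ℕ) (r : ℕ → ℝ) :
    ∏ n ∈ Finset.Icc 2 (m + 1), r n = ∏ i ∈ Finset.range m, r (i + 2) := by
  induction m with
  | zero => simp
  | succ m ih => rw [Finset.prod_Icc_succ_top (by omega), ih, Finset.prod_range_succ]

lemma det_offsiteA (m : ℕ) (r : ℕ → ℝ) :
    (offsiteA (m + 2) r).det =
      (-1) ^ (m + 3) * (∏ i ∈ Finset.range m, r (i + 2)) *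
        ∑ n ∈ Finset.Icc 1 (m + 2), r n ^ 2 := by
  induction m with
  | zero =>
    rw [Matrix.det_fin_two]
    simp [offsiteA, Finset.sum_Icc_succ_top]
    ring
  | succ m ih =>
    rw [det_offsiteA_succ (m + 2) (by omega), ih,
      Finset.sum_Icc_succ_top (b := m + 2) (by omega)]
    simp only [Finset.prod_range_succ]
    ring

/-- Determinant of the off-site core phase Jacobian:
`det A = (−1)^{k+1} (∏_{n=2}^{k−1} r_n) (∑_{n=1}^{k} r_n²)`, and `A` is
invertible whenever `r_n ≠ 0` for all `2 ≤ n ≤ k−1` and some `r_n ≠ 0`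
with `1 ≤ n ≤ k`. -/
theorem offsite_core_phase_det (k : ℕ) (hk : 2 ≤ k) (r : ℕ → ℝ) :
    (offsiteA k r).det =
      (-1 : ℝ) ^ (k + 1) * (∏ n ∈ Finset.Icc 2 (k - 1), r n) *
        (∑ n ∈ Finset.Icc 1 k, (r n) ^ 2) ∧
    ((∀ n, 2 ≤ n → n ≤ k - 1 → r n ≠ 0) → (∃ n, 1 ≤ n ∧ n ≤ k ∧ r n ≠ 0) →
      IsUnit (offsiteA k r)) := by
  have hdet : (offsiteA k r).det =
      (-1 : ℝ) ^ (k + 1) * (∏ n ∈ Finset.Icc 2 (k - 1), r n) *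
        (∑ n ∈ Finset.Icc 1 k, (r n) ^ 2) := by
    obtain ⟨m, rfl⟩ := Nat.exists_eq_add_of_le' hk
    rw [det_offsiteA, show m + 2 - 1 = m + 1 by omega, prod_Icc_two_eq_prod_range]
  refine ⟨hdet, fun hr ⟨n, hn₁, hnk, hn⟩ => ?_⟩
  rw [Matrix.isUnit_iff_isUnit_det, isUnit_iff_ne_zero, hdet]
  have hprod : ∏ n ∈ Finset.Icc 2 (k - 1), r n ≠ 0 :=
    Finset.prod_ne_zero_iff.mpr fun i hi =>
      hr i (Finset.mem_Icc.mp hi).1 (Finset.mem_Icc.mp hi).2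
  have hsum : 0 < ∑ n ∈ Finset.Icc 1 k, r n ^ 2 :=
    Finset.sum_pos' (fun i _ => sq_nonneg (r i))
      ⟨n, Finset.mem_Icc.mpr ⟨hn₁, hnk⟩, by positivity⟩
  exact mul_ne_zero (mul_ne_zero (by simp) hprod) hsum.ne'
end
end

section
/- Determinant of the on-site core phase Jacobian: Let k ≥ 2 and r_1, …, r_k ∈ ℝ. Let A be the k × k real matrix with entries A_{1,2} = 2 r_2, A_{n,1} = r_n for 1 ≤ n ≤ k, A_{n,n+1} = r_{n+1} for 2 ≤ n ≤ k−1, A_{n,n} = −r_{n−1} for 2 ≤ n ≤ k, and all other entries zero. Then det A = (−1)^{k+1} (∏_{n=2}^{k−1} r_n) (r_1² + 2 ∑_{n=2}^{k} r_n²) (the product being 1 when k = 2). In particular, A is invertible whenever r_n ≠ 0 for all 2 ≤ n ≤ k−1 and (r_1, …, r_k) ≠ 0. -/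
noncomputable section

/-- The on-site core phase Jacobian: rows/columns are 0-indexed, so row `i`
is the paper's row `n = i + 1` and column `j` is the paper's column `j + 1`
(column `1` is the `Ω`-column); the on-site boundary convention doubles the
`(1,2)` entry to `2 r₂`. -/
def onsiteA (k : ℕ) (r : ℕ → ℝ) : Matrix (Fin k) (Fin k) ℝ :=
  Matrix.of fun i j =>
    if (i : ℕ) = 0 ∧ (j : ℕ) = 1 then 2 * r 2
    else if (j : ℕ) = 0 then r ((i : ℕ) + 1)
    else if (j : ℕ) = (i : ℕ) + 1 then r ((i : ℕ) + 2)
    else if (j : ℕ) = (i : ℕ) then -r (i : ℕ)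
    else 0

/-- Deleting the last row and the first column of `onsiteA` leaves a lower triangular matrix. -/
lemma det_onsiteA_submatrix_castSucc_succ (p : ℕ) (r : ℕ → ℝ) :
    ((onsiteA (p + 2) r).submatrix Fin.castSucc Fin.succ).det =
      2 * ∏ n ∈ Finset.Icc 2 (p + 2), r n := by
  rw [Matrix.det_of_isLowerTriangular]
  · have hprod : ∏ n ∈ Finset.Icc 2 (p + 2), r n = r 2 * ∏ i ∈ Finset.range p, r (i + 3) := by
      induction p with
      | zero => simp
      | succ p ih =>
        rw [Finset.prod_Icc_succ_top (by omega), ih, Finset.prod_range_succ, mul_assoc]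
    rw [hprod, Fin.prod_univ_succ, ← Fin.prod_univ_eq_prod_range (fun i => r (i + 3))]
    simp [onsiteA, mul_assoc]
  · intro i j hij
    have hij' : (i : ℕ) < j := hij
    simp only [onsiteA, Matrix.submatrix_apply, Matrix.of_apply, Fin.val_castSucc, Fin.val_succ]
    grind

lemma det_onsiteA_succ (p : ℕ) (r : ℕ → ℝ) :
    (onsiteA (p + 3) r).det =
      (-1) ^ p * r (p + 3) * (2 * ∏ n ∈ Finset.Icc 2 (p + 3), r n) -
        r (p + 2) * (onsiteA (p + 2) r).det := by
  have hsub : (onsiteA (p + 3) r).submatrix Fin.castSucc Fin.castSucc = onsiteA (p + 2) r := by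
    ext i j
    simp [onsiteA]
  have hzero : ∀ j : Fin (p + 1), onsiteA (p + 3) r (Fin.last (p + 2)) j.succ.castSucc = 0 := by
    intro j
    simp only [onsiteA, Matrix.of_apply, Fin.val_castSucc, Fin.val_succ, Fin.val_last]
    grind
  have hfirst : onsiteA (p + 3) r (Fin.last (p + 2)) 0 = r (p + 3) := by
    simp [onsiteA]
  have hlast : onsiteA (p + 3) r (Fin.last (p + 2)) (Fin.last (p + 2)) = -r (p + 2) := by
    simp [onsiteA]
  rw [Matrix.det_succ_row _ (Fin.last (p + 2)), Fin.sum_univ_castSucc, Fin.sum_univ_succ]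
  simp only [hzero, Fin.castSucc_zero, hfirst, hlast, Fin.succAbove_last, Fin.succAbove_zero,
    hsub, mul_zero, zero_mul, Finset.sum_const_zero, Fin.val_last, Fin.val_zero,
    det_onsiteA_submatrix_castSucc_succ (p + 1) r]
  rw [Even.neg_one_pow (⟨p + 2, rfl⟩ : Even (p + 2 + (p + 2)))]
  ring

lemma det_onsiteA (p : ℕ) (r : ℕ → ℝ) :
    (onsiteA (p + 2) r).det =
      (-1) ^ (p + 3) * (∏ n ∈ Finset.Icc 2 (p + 1), r n) *
        (r 1 ^ 2 + 2 * ∑ n ∈ Finset.Icc 2 (p + 2), r n ^ 2) := by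
  induction p with
  | zero =>
    simp [Matrix.det_fin_two, onsiteA]
    ring
  | succ p ih =>
    rw [det_onsiteA_succ, ih, Finset.prod_Icc_succ_top (b := p + 2) (by omega),
      Finset.prod_Icc_succ_top (b := p + 1) (by omega),
      Finset.sum_Icc_succ_top (b := p + 2) (by omega)]
    ring

/-- Determinant of the on-site core phase Jacobian:
`det A = (−1)^{k+1} (∏_{n=2}^{k−1} r_n) (r_1² + 2 ∑_{n=2}^{k} r_n²)`, and `A`
is invertible whenever `r_n ≠ 0` for all `2 ≤ n ≤ k−1` and some `r_n ≠ 0`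
with `1 ≤ n ≤ k`. -/
theorem onsite_core_phase_det (k : ℕ) (hk : 2 ≤ k) (r : ℕ → ℝ) :
    (onsiteA k r).det =
      (-1 : ℝ) ^ (k + 1) * (∏ n ∈ Finset.Icc 2 (k - 1), r n) *
        ((r 1) ^ 2 + 2 * ∑ n ∈ Finset.Icc 2 k, (r n) ^ 2) ∧
    ((∀ n, 2 ≤ n → n ≤ k - 1 → r n ≠ 0) → (∃ n, 1 ≤ n ∧ n ≤ k ∧ r n ≠ 0) →
      IsUnit (onsiteA k r)) := by
  obtain ⟨p, rfl⟩ := Nat.exists_eq_add_of_le' hk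
  refine ⟨det_onsiteA p r, fun hr ⟨m, hm1, hmk, hm⟩ => ?_⟩
  rw [Matrix.isUnit_iff_isUnit_det, isUnit_iff_ne_zero, det_onsiteA]
  have hprod : ∏ n ∈ Finset.Icc 2 (p + 1), r n ≠ 0 :=
    Finset.prod_ne_zero_iff.mpr fun n hn =>
      hr n (Finset.mem_Icc.mp hn).1 (Finset.mem_Icc.mp hn).2
  have hnonneg : 0 ≤ ∑ n ∈ Finset.Icc 2 (p + 2), r n ^ 2 :=
    Finset.sum_nonneg fun n _ => sq_nonneg (r n)
  have hpos : 0 < r m ^ 2 := by positivity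
  refine mul_ne_zero (mul_ne_zero (by simp) hprod) (ne_of_gt ?_)
  obtain rfl | hm2 := hm1.eq_or_lt
  · positivity
  · have hle : r m ^ 2 ≤ ∑ n ∈ Finset.Icc 2 (p + 2), r n ^ 2 :=
      Finset.single_le_sum (f := fun n => r n ^ 2) (fun n _ => sq_nonneg (r n))
        (Finset.mem_Icc.mpr ⟨hm2, hmk⟩)
    nlinarith [sq_nonneg (r 1)]
end
end

section
/- Necessary condition for localized patterns under O(ε) frequency mismatch (core of Lemma 2.4(ii)): Let k ≥ 2, and let r_+, r_− > 0 and ω_+, ω_− ∈ ℝ. Suppose there exist Ω ∈ ℝ and φ_1, …, φ_k ∈ ℝ satisfying: ω_+ − Ω + sin φ_1 = 0; ω_+ − Ω + sin φ_n − sin φ_{n−1} = 0 for 2 ≤ n ≤ k−1; ω_+ − Ω + (r_−/r_+) sin φ_k − sin φ_{k−1} = 0; and ω_− − Ω − (r_+/r_−) sin φ_k = 0. Then |ω_− − ω_+| ≤ r_+/r_− + r_−/(k r_+). Consequently, if |ω_− − ω_+| > r_+/r_−, there exists k_* ≥ 2 such that this system has no solution (Ω, φ) for any k ≥ k_*. 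-/
noncomputable section

/-- The reduced (`ε = 0`) phase system for the amplitude pattern
`(r₊, …, r₊ [k entries], r₋, 0, …, 0)` with off-site boundary convention
`φ₀ = 0`. -/
def PhaseSys (k : ℕ) (rp rm ωp ωm : ℝ) (Ω : ℝ) (φ : ℕ → ℝ) : Prop :=
  (ωp - Ω + Real.sin (φ 1) = 0) ∧
  (∀ n, 2 ≤ n → n ≤ k - 1 → ωp - Ω + Real.sin (φ n) - Real.sin (φ (n - 1)) = 0) ∧
  (ωp - Ω + (rm / rp) * Real.sin (φ k) - Real.sin (φ (k - 1)) = 0) ∧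
  (ωm - Ω - (rp / rm) * Real.sin (φ k) = 0)

/-- Along the chain, `sin φₙ` grows linearly in `n`. -/
theorem PhaseSys.sin_eq {k : ℕ} {rp rm ωp ωm Ω : ℝ} {φ : ℕ → ℝ}
    (h : PhaseSys k rp rm ωp ωm Ω φ) {n : ℕ} (hn : 1 ≤ n) (hnk : n ≤ k - 1) :
    Real.sin (φ n) = n * (Ω - ωp) := by
  induction n, hn using Nat.le_induction with
  | base => push_cast; linarith [h.1]
  | succ n hn ih =>
    have hstep := h.2.1 (n + 1) (by omega) hnk
    rw [Nat.add_sub_cancel, ih (by omega)] at hstep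
    push_cast
    linarith

/-- A solution of the phase system determines the frequency mismatch from `sin φₖ`. -/
theorem PhaseSys.mismatch_eq {k : ℕ} {rp rm ωp ωm Ω : ℝ} {φ : ℕ → ℝ} (hk : 2 ≤ k)
    (h : PhaseSys k rp rm ωp ωm Ω φ) :
    ωm - ωp = (rp / rm + rm / ((k : ℝ) * rp)) * Real.sin (φ k) := by
  have hk0 : (k : ℝ) ≠ 0 := by positivity
  have hlast := h.2.2.1
  rw [h.sin_eq (n := k - 1) (by omega) le_rfl, Nat.cast_sub (by omega), Nat.cast_one] at hlast
  have hΩ : Ω - ωp = rm / (k * rp) * Real.sin (φ k) := by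
    have hsum : rm / rp * Real.sin (φ k) = k * (Ω - ωp) := by linarith
    rw [mul_comm (k : ℝ) rp, ← div_div, div_mul_eq_mul_div, hsum, mul_div_cancel_left₀ _ hk0]
  linarith [h.2.2.2]

/-- A solution of the phase system bounds the frequency mismatch. -/
theorem PhaseSys.abs_mismatch_le {k : ℕ} {rp rm ωp ωm Ω : ℝ} {φ : ℕ → ℝ} (hk : 2 ≤ k)
    (hrp : 0 < rp) (hrm : 0 < rm) (h : PhaseSys k rp rm ωp ωm Ω φ) :
    |ωm - ωp| ≤ rp / rm + rm / ((k : ℝ) * rp) := by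
  have hnonneg : 0 ≤ rp / rm + rm / ((k : ℝ) * rp) := by positivity
  rw [h.mismatch_eq hk, abs_mul, abs_of_nonneg hnonneg]
  exact mul_le_of_le_one_right hnonneg (Real.abs_sin_le_one _)

/-- Necessary condition for localized patterns under `O(ε)` frequency mismatch
(core of Lemma 2.4(ii)): any solution of the reduced phase system forces
`|ω₋ − ω₊| ≤ r₊/r₋ + r₋/(k r₊)`; consequently, if `|ω₋ − ω₊| > r₊/r₋`, the
system is unsolvable for all sufficiently large `k`. -/
theorem freq_mismatch_core (rp rm ωp ωm : ℝ) (hrp : 0 < rp) (hrm : 0 < rm) :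
    (∀ k : ℕ, 2 ≤ k → ∀ Ω : ℝ, ∀ φ : ℕ → ℝ, PhaseSys k rp rm ωp ωm Ω φ →
      |ωm - ωp| ≤ rp / rm + rm / ((k : ℝ) * rp)) ∧
    (rp / rm < |ωm - ωp| →
      ∃ kstar : ℕ, 2 ≤ kstar ∧ ∀ k : ℕ, kstar ≤ k →
        ¬ ∃ Ω : ℝ, ∃ φ : ℕ → ℝ, PhaseSys k rp rm ωp ωm Ω φ) := by
  refine ⟨fun k hk Ω φ h => h.abs_mismatch_le hk hrp hrm, fun hgap => ?_⟩
  have hd : 0 < |ωm - ωp| - rp / rm := sub_pos.mpr hgap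
  obtain ⟨N, hN⟩ := exists_nat_gt (rm / rp / (|ωm - ωp| - rp / rm))
  refine ⟨max N 2, le_max_right _ _, ?_⟩
  rintro k hk ⟨Ω, φ, h⟩
  have hk2 : 2 ≤ k := (le_max_right _ _).trans hk
  have hNk : (N : ℝ) ≤ k := Nat.cast_le.mpr ((le_max_left _ _).trans hk)
  have hk0 : (0 : ℝ) < k := by positivity
  have hsmall : rm / ((k : ℝ) * rp) < |ωm - ωp| - rp / rm := by
    rw [mul_comm, ← div_div, div_lt_comm₀ hk0 hd]
    exact hN.trans_le hNk
  linarith [h.abs_mismatch_le hk2 hrp hrm]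
end
end

section
/- Fold-region chart ε̃ = 1 (solving the rescaled fold system): Let k ≥ 1 and let R : ℝ^k × ℝ × ℝ → ℝ^k be continuously differentiable. Define G : ℝ^k × ℝ × ℝ → ℝ^k by G_n(σ, μ̃, ν) = μ̃ − σ_n² + ν R_n(σ, μ̃, ν) for 1 ≤ n ≤ k−1 and G_k(σ, μ̃, ν) = μ̃ − σ_k² − 1 + ν R_k(σ, μ̃, ν). Then there exist ν_0 > 0, δ > 0, C > 0 and continuously differentiable functions μ̃ : [−1,1] × [0, ν_0) → ℝ and σ_n : [−1,1] × [0, ν_0) → ℝ (1 ≤ n ≤ k−1) with μ̃(s, 0) = 1 + s² and σ_n(s, 0) = √(1 + s²), such that G((σ_1(s,ν), …, σ_{k−1}(s,ν), s), μ̃(s,ν), ν) = 0 for all (s, ν) ∈ [−1,1] × [0, ν_0), with |μ̃(s,ν) − (1+s²)| + ∑_n |σ_n(s,ν) − √(1+s²)| ≤ C ν; moreover, any solution (σ, μ̃', ν) of G = 0 with σ_k = s ∈ [−1,1], ν ∈ [0, ν_0), |μ̃' − (1+s²)| < δ and |σ_n − √(1+s²)| < δ for all n < k coincides with this one. -/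
noncomputable section

open Set

/-- The rescaled fold system in the chart `ε̃ = 1` (0-indexed: component `i`
is the paper's equation `n = i + 1`):
`G_n = μ̃ − σ_n² + ν R_n` for `1 ≤ n ≤ k−1` and
`G_k = μ̃ − σ_k² − 1 + ν R_k`. -/
def GfoldEps (k : ℕ) (R : (Fin k → ℝ) × ℝ × ℝ → Fin k → ℝ)
    (σ : Fin k → ℝ) (μt ν : ℝ) : Fin k → ℝ := fun i =>
  if (i : ℕ) + 1 < k then μt - (σ i) ^ 2 + ν * R (σ, μt, ν) i
  else μt - (σ i) ^ 2 - 1 + ν * R (σ, μt, ν) i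

open Filter Topology

/-- Inverse function theorem along a compact set: a `C¹` map which is injective on a compact
set `K` and has invertible derivative at every point of `K` has a `C¹` inverse on a
neighbourhood of the image of `K`. -/
theorem ContDiff.exists_contDiffOn_inverse_of_isCompact {E F : Type*}
    [NormedAddCommGroup E] [NormedSpace ℝ E] [CompleteSpace E]
    [NormedAddCommGroup F] [NormedSpace ℝ F]
    {f : E → F} (hf : ContDiff ℝ 1 f) {K : Set E} (hK : IsCompact K) (hinj : InjOn f K)
    (hderiv : ∀ x ∈ K, ∃ e : E ≃L[ℝ] F, (e : E →L[ℝ] F) = fderiv ℝ f x) :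
    ∃ (U : Set E) (g : F → E), IsOpen U ∧ K ⊆ U ∧ InjOn f U ∧ IsOpen (f '' U) ∧
      ContDiffOn ℝ 1 g (f '' U) ∧ ∀ y ∈ f '' U, g y ∈ U ∧ f (g y) = y := by
  have hstrict (x : E) (e : E ≃L[ℝ] F) (he : (e : E →L[ℝ] F) = fderiv ℝ f x) :
      HasStrictFDerivAt f (e : E →L[ℝ] F) x := by
    rw [he]
    exact hf.contDiffAt.hasStrictFDerivAt one_ne_zero
  obtain ⟨t, ht, htinj⟩ := hinj.exists_mem_nhdsSet hK
    (fun x _ => hf.continuous.continuousAt) (fun x hx => by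
      obtain ⟨e, he⟩ := hderiv x hx
      let φ := (hstrict x e he).toOpenPartialHomeomorph f
      exact ⟨φ.source, φ.open_source.mem_nhds
        (hstrict x e he).mem_toOpenPartialHomeomorph_source, φ.injOn⟩)
  obtain ⟨W, hWo, hKW, hWt⟩ := mem_nhdsSet_iff_exists.1 ht
  set U : Set E := W ∩ fderiv ℝ f ⁻¹' range ((↑) : (E ≃L[ℝ] F) → E →L[ℝ] F)
  have hUo : IsOpen U := hWo.inter
    (ContinuousLinearEquiv.isOpen.preimage (hf.continuous_fderiv one_ne_zero))
  have hUinj : InjOn f U := htinj.mono (inter_subset_left.trans hWt)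
  have hmem : ∀ y ∈ f '' U, Function.invFunOn f U y ∈ U ∧ f (Function.invFunOn f U y) = y :=
    fun y hy => Function.invFunOn_pos hy
  have himg : IsOpen (f '' U) := by
    rw [isOpen_iff_mem_nhds]
    rintro _ ⟨x, hx, rfl⟩
    obtain ⟨e, he⟩ := hx.2
    rw [← (hstrict x e he).map_nhds_eq_of_equiv]
    exact image_mem_map (hUo.mem_nhds hx)
  refine ⟨U, Function.invFunOn f U, hUo, fun x hx => ⟨hKW hx, hderiv x hx⟩, hUinj, himg,
    ?_, hmem⟩
  rintro _ ⟨x, hx, rfl⟩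
  obtain ⟨e, he⟩ := hx.2
  have hs := hstrict x e he
  have hlocal : ContDiffAt ℝ 1 (hs.localInverse f e x) (f x) :=
    hf.contDiffAt.to_localInverse hs.hasFDerivAt one_ne_zero
  refine (hlocal.congr_of_eventuallyEq ?_).contDiffWithinAt
  filter_upwards [hs.eventually_right_inverse, himg.mem_nhds (mem_image_of_mem f hx),
    hs.localInverse_tendsto (hUo.mem_nhds hx)] with y hy hyU hyl
  exact hUinj (hmem y hyU).1 hyl ((hmem y hyU).2.trans hy.symm)

/-- The fold system augmented by the parameters `(σ_k, ν)`. -/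
def foldAugmented (k : ℕ) (last : Fin k) (R : (Fin k → ℝ) × ℝ × ℝ → Fin k → ℝ)
    (p : (Fin k → ℝ) × ℝ × ℝ) : ℝ × ℝ × (Fin k → ℝ) :=
  (p.1 last, p.2.2, GfoldEps k R p.1 p.2.1 p.2.2)

/-- The explicit solution at `ν = 0` with `σ_k = s`. -/
def foldBase (k : ℕ) (s : ℝ) : (Fin k → ℝ) × ℝ × ℝ :=
  (fun i => if (i : ℕ) + 1 < k then Real.sqrt (1 + s ^ 2) else s, 1 + s ^ 2, 0)

theorem continuous_foldBase (k : ℕ) : Continuous (foldBase k) := by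
  unfold foldBase
  refine Continuous.prodMk (continuous_pi fun i => ?_) (by fun_prop)
  split_ifs <;> fun_prop

theorem GfoldEps_apply (k : ℕ) (R : (Fin k → ℝ) × ℝ × ℝ → Fin k → ℝ)
    (σ : Fin k → ℝ) (μt ν : ℝ) (i : Fin k) :
    GfoldEps k R σ μt ν i =
      μt - (σ i) ^ 2 - (if (i : ℕ) + 1 < k then 0 else 1) + ν * R (σ, μt, ν) i := by
  unfold GfoldEps
  split_ifs <;> ring

theorem foldAugmented_foldBase (k : ℕ) (last : Fin k) (hlast : ¬ (last : ℕ) + 1 < k)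
    (R : (Fin k → ℝ) × ℝ × ℝ → Fin k → ℝ) (s : ℝ) :
    foldAugmented k last R (foldBase k s) = (s, 0, 0) := by
  have hG : GfoldEps k R (foldBase k s).1 (1 + s ^ 2) 0 = 0 := by
    funext i
    rw [GfoldEps_apply]
    by_cases h : (i : ℕ) + 1 < k
    · simp [foldBase, h, Real.sq_sqrt (by positivity : (0 : ℝ) ≤ 1 + s ^ 2)]
    · simp [foldBase, h]
  have hσ : (foldBase k s).1 last = s := by simp [foldBase, hlast]
  exact Prod.ext hσ (Prod.ext rfl hG)

theorem contDiff_foldAugmented (k : ℕ) (last : Fin k)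
    {R : (Fin k → ℝ) × ℝ × ℝ → Fin k → ℝ} (hR : ContDiff ℝ 1 R) :
    ContDiff ℝ 1 (foldAugmented k last R) := by
  have hG : ContDiff ℝ 1 (fun p : (Fin k → ℝ) × ℝ × ℝ => GfoldEps k R p.1 p.2.1 p.2.2) := by
    rw [contDiff_pi]
    intro i
    simp only [GfoldEps_apply]
    fun_prop
  unfold foldAugmented
  fun_prop

/-- At `ν = 0` the remainder enters the linearized fold system only through the `ν`-direction. -/
theorem fderiv_foldAugmented (k : ℕ) (last : Fin k)
    {R : (Fin k → ℝ) × ℝ × ℝ → Fin k → ℝ} (hR : ContDiff ℝ 1 R)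
    (σ : Fin k → ℝ) (μt : ℝ) (v : (Fin k → ℝ) × ℝ × ℝ) :
    fderiv ℝ (foldAugmented k last R) (σ, μt, 0) v =
      (v.1 last, v.2.2, fun i => v.2.1 - 2 * σ i * v.1 i + v.2.2 * R (σ, μt, 0) i) := by
  let πσ (i : Fin k) : ((Fin k → ℝ) × ℝ × ℝ) →L[ℝ] ℝ :=
    (ContinuousLinearMap.proj (R := ℝ) (φ := fun _ : Fin k => ℝ) i).comp
      (ContinuousLinearMap.fst ℝ (Fin k → ℝ) (ℝ × ℝ))
  let πμ : ((Fin k → ℝ) × ℝ × ℝ) →L[ℝ] ℝ :=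
    (ContinuousLinearMap.fst ℝ ℝ ℝ).comp (ContinuousLinearMap.snd ℝ (Fin k → ℝ) (ℝ × ℝ))
  let πν : ((Fin k → ℝ) × ℝ × ℝ) →L[ℝ] ℝ :=
    (ContinuousLinearMap.snd ℝ ℝ ℝ).comp (ContinuousLinearMap.snd ℝ (Fin k → ℝ) (ℝ × ℝ))
  have hσ (i : Fin k) : HasFDerivAt (fun p : (Fin k → ℝ) × ℝ × ℝ => p.1 i) (πσ i) (σ, μt, 0) :=
    (πσ i).hasFDerivAt
  have hμ : HasFDerivAt (fun p : (Fin k → ℝ) × ℝ × ℝ => p.2.1) πμ (σ, μt, 0) := πμ.hasFDerivAt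
  have hν : HasFDerivAt (fun p : (Fin k → ℝ) × ℝ × ℝ => p.2.2) πν (σ, μt, 0) := πν.hasFDerivAt
  have hRi (i : Fin k) :=
    hasFDerivAt_pi'.1 (hR.differentiable one_ne_zero (σ, μt, 0)).hasFDerivAt i
  have hG : HasFDerivAt (fun p : (Fin k → ℝ) × ℝ × ℝ => GfoldEps k R p.1 p.2.1 p.2.2)
      (ContinuousLinearMap.pi _) (σ, μt, 0) := hasFDerivAt_pi.2 fun i => by
    simp only [GfoldEps_apply]
    exact ((hμ.sub ((hσ i).pow 2)).sub_const _).add (hν.mul (hRi i))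
  have hΦ : HasFDerivAt (foldAugmented k last R) _ (σ, μt, 0) :=
    (hσ last).prodMk (hν.prodMk hG)
  rw [hΦ.fderiv]
  refine Prod.ext rfl (Prod.ext rfl (funext fun i => ?_))
  simp [πσ, πμ, πν, mul_comm]

theorem exists_equiv_fderiv_foldAugmented (k : ℕ) (last : Fin k)
    (hlast : ∀ i : Fin k, (i : ℕ) + 1 < k ↔ i ≠ last)
    {R : (Fin k → ℝ) × ℝ × ℝ → Fin k → ℝ} (hR : ContDiff ℝ 1 R) (s : ℝ) :
    ∃ e : ((Fin k → ℝ) × ℝ × ℝ) ≃L[ℝ] (ℝ × ℝ × (Fin k → ℝ)),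
      (e : ((Fin k → ℝ) × ℝ × ℝ) →L[ℝ] (ℝ × ℝ × (Fin k → ℝ))) =
        fderiv ℝ (foldAugmented k last R) (foldBase k s) := by
  have hinj : Function.Injective (fderiv ℝ (foldAugmented k last R) (foldBase k s)) := by
    rw [injective_iff_map_eq_zero]
    intro v hv
    rw [foldBase, fderiv_foldAugmented k last hR, Prod.mk_eq_zero, Prod.mk_eq_zero] at hv
    obtain ⟨hl, hν, hG⟩ := hv
    have hμ : v.2.1 = 0 := by simpa [hl, hν] using congrFun hG last
    have hσ : v.1 = 0 := by
      funext i
      by_cases h : i = last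
      · rw [h, hl, Pi.zero_apply]
      · have hi := congrFun hG i
        have hpos : Real.sqrt (1 + s ^ 2) ≠ 0 := (Real.sqrt_pos.2 (by positivity)).ne'
        simpa [hμ, hν, (hlast i).2 h, hpos] using hi
    exact Prod.ext hσ (Prod.ext hμ hν)
  have hdim : Module.finrank ℝ ((Fin k → ℝ) × ℝ × ℝ) =
      Module.finrank ℝ (ℝ × ℝ × (Fin k → ℝ)) := by
    simp
    ring
  exact ⟨(LinearMap.linearEquivOfInjective _ hinj hdim).toContinuousLinearEquiv, by ext <;> rfl⟩

/-- Fold-region chart `ε̃ = 1`: the rescaled fold system is uniquely solvable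
for `(σ_1, …, σ_{k−1}, μ̃)` in terms of `σ_k = s ∈ [−1, 1]` and small `ν ≥ 0`,
near the explicit solution `μ̃ = 1 + s²`, `σ_n = √(1 + s²)`. -/
theorem fold_chart_eps (k : ℕ) (hk : 1 ≤ k)
    (R : (Fin k → ℝ) × ℝ × ℝ → Fin k → ℝ) (hR : ContDiff ℝ 1 R) :
    ∃ ν0 > (0:ℝ), ∃ δ > (0:ℝ), ∃ C > (0:ℝ),
      ∃ mt : ℝ × ℝ → ℝ, ∃ sg : Fin k → ℝ × ℝ → ℝ,
        ContDiffOn ℝ 1 mt (Icc (-1:ℝ) 1 ×ˢ Ico (0:ℝ) ν0) ∧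
        (∀ i : Fin k, (i : ℕ) + 1 < k →
          ContDiffOn ℝ 1 (sg i) (Icc (-1:ℝ) 1 ×ˢ Ico (0:ℝ) ν0)) ∧
        (∀ s ∈ Icc (-1:ℝ) 1, mt (s, 0) = 1 + s ^ 2 ∧
          ∀ i : Fin k, (i : ℕ) + 1 < k → sg i (s, 0) = Real.sqrt (1 + s ^ 2)) ∧
        (∀ s ∈ Icc (-1:ℝ) 1, ∀ ν ∈ Ico (0:ℝ) ν0,
          GfoldEps k R (fun i => if (i : ℕ) + 1 < k then sg i (s, ν) else s)
              (mt (s, ν)) ν = 0 ∧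
          |mt (s, ν) - (1 + s ^ 2)| +
            ∑ i ∈ Finset.univ.filter (fun i : Fin k => (i : ℕ) + 1 < k),
              |sg i (s, ν) - Real.sqrt (1 + s ^ 2)| ≤ C * ν) ∧
        (∀ s ∈ Icc (-1:ℝ) 1, ∀ ν ∈ Ico (0:ℝ) ν0, ∀ σ : Fin k → ℝ, ∀ μt' : ℝ,
          σ ⟨k - 1, by omega⟩ = s →
          GfoldEps k R σ μt' ν = 0 →
          |μt' - (1 + s ^ 2)| < δ →
          (∀ i : Fin k, (i : ℕ) + 1 < k → |σ i - Real.sqrt (1 + s ^ 2)| < δ) →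
          μt' = mt (s, ν) ∧
            σ = fun i : Fin k => if (i : ℕ) + 1 < k then sg i (s, ν) else s) := by
  set last : Fin k := ⟨k - 1, by omega⟩ with hlast_def
  have hlast (i : Fin k) : (i : ℕ) + 1 < k ↔ i ≠ last := by
    rw [Ne, Fin.ext_iff]
    simp only [hlast_def]
    omega
  have hlast' : ¬ (last : ℕ) + 1 < k := fun h => (hlast last).1 h rfl
  have hbase (s : ℝ) := foldAugmented_foldBase k last hlast' R s
  obtain ⟨U, g, hUo, hKU, hinj, hVo, hg, hgU⟩ :=
    (contDiff_foldAugmented k last hR).exists_contDiffOn_inverse_of_isCompact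
      ((isCompact_Icc (a := (-1 : ℝ)) (b := 1)).image (continuous_foldBase k))
      (by
        rintro _ ⟨s, _, rfl⟩ _ ⟨s', _, rfl⟩ h
        rw [hbase, hbase] at h
        exact congrArg (foldBase k) (Prod.ext_iff.1 h).1)
      (by
        rintro _ ⟨s, _, rfl⟩
        exact exists_equiv_fderiv_foldAugmented k last hlast hR s)
  have hbaseU (s : ℝ) (hs : s ∈ Icc (-1 : ℝ) 1) : foldBase k s ∈ U :=
    hKU (mem_image_of_mem _ hs)
  obtain ⟨δ, hδ, hδU⟩ := ((isCompact_Icc (a := (-1 : ℝ)) (b := 1)).image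
    (continuous_foldBase k)).exists_thickening_subset_open hUo hKU
  -- `ι` embeds the parameters `(s, ν)` as the targets with vanishing fold system.
  let ι : ℝ × ℝ → ℝ × ℝ × (Fin k → ℝ) := fun q => (q.1, q.2, 0)
  have hι : ContDiff ℝ 1 ι := by fun_prop
  have hιV : Icc (-1 : ℝ) 1 ×ˢ {(0 : ℝ)} ⊆ ι ⁻¹' (foldAugmented k last R '' U) := by
    rintro ⟨s, ν⟩ ⟨hs, hν⟩
    obtain rfl : ν = 0 := hν
    exact ⟨foldBase k s, hbaseU s hs, hbase s⟩
  obtain ⟨η, hη, hηV⟩ := (isCompact_Icc.prod isCompact_singleton).exists_thickening_subset_open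
    (hVo.preimage hι.continuous) hιV
  set ν0 := min δ (η / 2)
  have hν0 : 0 < ν0 := lt_min hδ (half_pos hη)
  have hmemV : Icc (-1 : ℝ) 1 ×ˢ Icc 0 ν0 ⊆ ι ⁻¹' (foldAugmented k last R '' U) := by
    rintro ⟨s, ν⟩ ⟨hs, hν⟩
    refine hηV (Metric.mem_thickening_iff.2 ⟨(s, 0), ⟨hs, rfl⟩, ?_⟩)
    have : ν < η := (hν.2.trans (min_le_right _ _)).trans_lt (half_lt_self hη)
    simpa [Prod.dist_eq, Real.dist_eq, abs_of_nonneg hν.1, hη] using this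
  have hgι (q : ℝ × ℝ) (hq : q ∈ Icc (-1 : ℝ) 1 ×ˢ Icc 0 ν0) : ContDiffAt ℝ 1 (g ∘ ι) q :=
    (hg.contDiffAt (hVo.mem_nhds (hmemV hq))).comp q hι.contDiffAt
  have hsub : Icc (-1 : ℝ) 1 ×ˢ Ico 0 ν0 ⊆ Icc (-1 : ℝ) 1 ×ˢ Icc 0 ν0 :=
    prod_mono le_rfl Ico_subset_Icc_self
  have hgιOn : ContDiffOn ℝ 1 (g ∘ ι) (Icc (-1 : ℝ) 1 ×ˢ Ico 0 ν0) :=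
    fun q hq => (hgι q (hsub hq)).contDiffWithinAt
  obtain ⟨L, hL⟩ := LocallyLipschitzOn.exists_lipschitzOnWith_of_compact
    (f := g ∘ ι) (s := Icc (-1 : ℝ) 1 ×ˢ Icc 0 ν0) (isCompact_Icc.prod isCompact_Icc)
    (fun q hq => by
      obtain ⟨L, t, ht, hLt⟩ := (hgι q hq).exists_lipschitzOnWith
      exact ⟨L, t, mem_nhdsWithin_of_mem_nhds ht, hLt⟩)
  have hg0 (s : ℝ) (hs : s ∈ Icc (-1 : ℝ) 1) : g (ι (s, 0)) = foldBase k s := by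
    have h := hgU _ (hmemV (show (s, (0 : ℝ)) ∈ _ from ⟨hs, le_rfl, hν0.le⟩))
    exact hinj h.1 (hbaseU s hs) (h.2.trans (hbase s).symm)
  have hgmem (s : ℝ) (hs : s ∈ Icc (-1 : ℝ) 1) (ν : ℝ) (hν : ν ∈ Ico 0 ν0) :
      g (ι (s, ν)) ∈ U ∧ foldAugmented k last R (g (ι (s, ν))) = ι (s, ν) :=
    hgU _ (hmemV (hsub (mk_mem_prod hs hν)))
  have hdist (s : ℝ) (hs : s ∈ Icc (-1 : ℝ) 1) (ν : ℝ) (hν : ν ∈ Ico 0 ν0) :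
      ‖g (ι (s, ν)) - foldBase k s‖ ≤ L * ν := by
    have h := hL.dist_le_mul (s, ν) (hsub ⟨hs, hν⟩) (s, 0) ⟨hs, le_rfl, hν0.le⟩
    simpa [hg0 s hs, dist_eq_norm, Prod.norm_def, abs_of_nonneg hν.1, hν.1] using h
  have hsol (s : ℝ) (hs : s ∈ Icc (-1 : ℝ) 1) (ν : ℝ) (hν : ν ∈ Ico 0 ν0) :
      (fun i : Fin k => if (i : ℕ) + 1 < k then (g (ι (s, ν))).1 i else s) = (g (ι (s, ν))).1 ∧
        (g (ι (s, ν))).2.2 = ν ∧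
        GfoldEps k R (g (ι (s, ν))).1 (g (ι (s, ν))).2.1 (g (ι (s, ν))).2.2 = 0 := by
    obtain ⟨h₁, h₂⟩ := Prod.ext_iff.1 (hgmem s hs ν hν).2
    obtain ⟨h₂, h₃⟩ := Prod.ext_iff.1 h₂
    refine ⟨funext fun i => ?_, h₂, h₃⟩
    split_ifs with h
    · rfl
    · rw [hlast, not_not] at h
      rw [h]
      exact h₁.symm
  refine ⟨ν0, hν0, δ, hδ, (1 + k) * (L + 1), by positivity, fun q => (g (ι q)).2.1,
    fun i q => (g (ι q)).1 i, hgιOn.snd.fst, fun i _ => contDiffOn_pi.1 hgιOn.fst i, ?_, ?_, ?_⟩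
  · intro s hs
    simp only [hg0 s hs]
    exact ⟨rfl, fun i hi => if_pos hi⟩
  · intro s hs ν hν
    obtain ⟨hσ, hνeq, hG⟩ := hsol s hs ν hν
    refine ⟨by rw [hσ]; rwa [hνeq] at hG, ?_⟩
    have hd := hdist s hs ν hν
    have hμ : |(g (ι (s, ν))).2.1 - (1 + s ^ 2)| ≤ L * ν :=
      ((norm_fst_le _).trans (norm_snd_le (g (ι (s, ν)) - foldBase k s))).trans hd
    have hσ' : ∀ i ∈ Finset.univ.filter (fun i : Fin k => (i : ℕ) + 1 < k),
        |(g (ι (s, ν))).1 i - Real.sqrt (1 + s ^ 2)| ≤ L * ν := by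
      intro i hi
      have h := ((norm_le_pi_norm _ i).trans
        (norm_fst_le (g (ι (s, ν)) - foldBase k s))).trans hd
      simpa [foldBase, (Finset.mem_filter.1 hi).2] using h
    have hcard : ((Finset.univ.filter (fun i : Fin k => (i : ℕ) + 1 < k)).card : ℝ) ≤ k := by
      exact_mod_cast (Finset.card_filter_le _ _).trans (Finset.card_fin k).le
    have hsum := Finset.sum_le_card_nsmul _ _ _ hσ'
    rw [nsmul_eq_mul] at hsum
    have hLν : 0 ≤ (L : ℝ) * ν := mul_nonneg L.2 hν.1
    have hkν : 0 ≤ (1 + (k : ℝ)) * ν := mul_nonneg (by positivity) hν.1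
    linarith [mul_le_mul_of_nonneg_right hcard hLν]
  · intro s hs ν hν σ μt hσ hG hμ hσn
    have hmem : (σ, μt, ν) ∈ U := by
      refine hδU (Metric.mem_thickening_iff.2 ⟨foldBase k s, mem_image_of_mem _ hs, ?_⟩)
      have hνδ : ν < δ := hν.2.trans_le (min_le_left _ _)
      have h₁ : dist σ (foldBase k s).1 < δ := by
        rw [dist_pi_lt_iff hδ]
        intro i
        by_cases h : (i : ℕ) + 1 < k
        · simpa [foldBase, h, Real.dist_eq] using hσn i h
        · have hi : i = last := by simpa [hlast] using h
          simpa [foldBase, h, hi, hlast', hσ] using hδ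
      have h₃ : dist ν 0 < δ := by simpa [Real.dist_eq, abs_of_nonneg hν.1] using hνδ
      exact max_lt h₁ (max_lt hμ h₃)
    have hval : foldAugmented k last R (σ, μt, ν) = ι (s, ν) :=
      Prod.ext hσ (Prod.ext rfl hG)
    have h := hgmem s hs ν hν
    have heq : (σ, μt, ν) = g (ι (s, ν)) := hinj hmem h.1 (hval.trans h.2.symm)
    rw [(hsol s hs ν hν).1]
    exact ⟨congrArg (·.2.1) heq, congrArg (·.1) heq⟩
end
end

section
/- Fold-region chart μ̃ = 2 (solving the rescaled fold system with ε̃ as unknown): Let k ≥ 1 and let R : ℝ^k × ℝ × ℝ → ℝ^k be continuously differentiable. Define G : ℝ^k × ℝ × ℝ → ℝ^k by G_n(σ, ε̃, ν) = 2 − σ_n² + ν R_n(σ, ε̃, ν) for 1 ≤ n ≤ k−1 and G_k(σ, ε̃, ν) = 2 − σ_k² − ε̃ + ν R_k(σ, ε̃, ν). Then there exist ν_0 > 0 and continuously differentiable functions ε̃ : [−2,2] × [0, ν_0) → ℝ and σ_n : [−2,2] × [0, ν_0) → ℝ (1 ≤ n ≤ k−1) with ε̃(s, 0) = 2 − s²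 and σ_n(s, 0) = √2, such that G((σ_1(s,ν), …, σ_{k−1}(s,ν), s), ε̃(s,ν), ν) = 0 for all (s, ν) ∈ [−2,2] × [0, ν_0), these solutions are locally unique, and for each ν ∈ [0, ν_0) the equation ε̃(s, ν) = 0 has exactly two solutions s^−(ν), s^+(ν) in [−2,2], which satisfy s^±(ν) → ±√2 as ν → 0. -/
noncomputable section

open Set

/-- The rescaled fold system in the chart `μ̃ = 2` (0-indexed: component `i`
is the paper's equation `n = i + 1`):
`G_n = 2 − σ_n² + ν R_n` for `1 ≤ n ≤ k−1` and
`G_k = 2 − σ_k² − ε̃ + ν R_k`. -/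
def GfoldMu (k : ℕ) (R : (Fin k → ℝ) × ℝ × ℝ → Fin k → ℝ)
    (σ : Fin k → ℝ) (et ν : ℝ) : Fin k → ℝ := fun i =>
  if (i : ℕ) + 1 < k then 2 - (σ i) ^ 2 + ν * R (σ, et, ν) i
  else 2 - (σ i) ^ 2 - et + ν * R (σ, et, ν) i

/-- Implicit function theorem along a compact set of solutions: if `F (p, x₀ p) = 0` on a compact
set `C` with invertible partial derivative in the second variable, then the equation `F (p, x) = 0`
has a `C¹` solution branch over a neighbourhood of `C`, which is unique near the graph of `x₀`. -/
theorem exists_implicitFunction_nhds_compact {P E : Type*}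
    [NormedAddCommGroup P] [NormedSpace ℝ P] [CompleteSpace P]
    [NormedAddCommGroup E] [NormedSpace ℝ E] [CompleteSpace E]
    {F : P × E → E} (hF : ContDiff ℝ 1 F) {C : Set P} (hC : IsCompact C) {x₀ : P → E}
    (hx₀ : ContinuousOn x₀ C) (hzero : ∀ p ∈ C, F (p, x₀ p) = 0)
    (hinv : ∀ p ∈ C, ∃ D : E ≃L[ℝ] E,
      HasFDerivAt (fun x => F (p, x)) (D : E →L[ℝ] E) (x₀ p)) :
    ∃ U : Set P, IsOpen U ∧ C ⊆ U ∧ ∃ δ > (0 : ℝ), ∃ X : P → E,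
      ContDiffOn ℝ 1 X U ∧ (∀ p ∈ C, X p = x₀ p) ∧ (∀ p ∈ U, F (p, X p) = 0) ∧
      ∀ p ∈ U, ∀ q ∈ C, ∀ x, dist p q < δ → dist x (x₀ q) < δ → F (p, x) = 0 → x = X p := by
  set Φ : P × E → P × E := fun a => (a.1, F a) with hΦ_def
  have hΦ : ContDiff ℝ 1 Φ := contDiff_fst.prodMk hF
  set K : Set (P × E) := (fun p => (p, x₀ p)) '' C with hK_def
  have hK : IsCompact K := hC.image_of_continuousOn (continuousOn_id.prodMk hx₀)
  set S : Set (P × E) := fderiv ℝ Φ ⁻¹'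
    range ((↑) : ((P × E) ≃L[ℝ] (P × E)) → (P × E) →L[ℝ] (P × E)) with hS_def
  have hS : IsOpen S := ContinuousLinearEquiv.isOpen.preimage (hΦ.continuous_fderiv one_ne_zero)
  have hKS : K ⊆ S := by
    rintro _ ⟨p, hp, rfl⟩
    obtain ⟨D, hD⟩ := hinv p hp
    have hF' : HasFDerivAt F (fderiv ℝ F (p, x₀ p)) (p, x₀ p) :=
      (hF.differentiable one_ne_zero _).hasFDerivAt
    have hD' : (fderiv ℝ F (p, x₀ p)).comp (ContinuousLinearMap.inr ℝ P E) = D :=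
      (hF'.comp (x₀ p) (hasFDerivAt_prodMk_right p (x₀ p))).unique hD
    refine ⟨(ContinuousLinearEquiv.refl ℝ P).skewProd D
      ((fderiv ℝ F (p, x₀ p)).comp (ContinuousLinearMap.inl ℝ P E)), ?_⟩
    have hΦ' : HasFDerivAt Φ
        ((ContinuousLinearMap.fst ℝ P E).prod (fderiv ℝ F (p, x₀ p))) (p, x₀ p) :=
      hasFDerivAt_fst.prodMk hF'
    rw [hΦ'.fderiv]
    refine ContinuousLinearMap.ext fun ⟨u, v⟩ => ?_
    have hv : D v = fderiv ℝ F (p, x₀ p) (0, v) := by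
      rw [← ContinuousLinearEquiv.coe_coe, ← hD']; simp
    simp [hv, ← map_add]
  have hstrict : ∀ a ∈ S, ∃ e : (P × E) ≃L[ℝ] (P × E),
      HasStrictFDerivAt Φ (e : (P × E) →L[ℝ] (P × E)) a := by
    rintro a ⟨e, he⟩
    exact ⟨e, he ▸ hΦ.contDiffAt.hasStrictFDerivAt one_ne_zero⟩
  have hinjK : InjOn Φ K := by
    rintro _ ⟨p, -, rfl⟩ _ ⟨q, -, rfl⟩ h
    obtain rfl : p = q := congrArg Prod.fst h
    rfl
  obtain ⟨t, ht, hinj⟩ := hinjK.exists_mem_nhdsSet hK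
    (fun a _ => hΦ.continuous.continuousAt) fun a ha => by
      obtain ⟨e, he⟩ := hstrict a (hKS ha)
      exact ⟨_, (he.toOpenPartialHomeomorph Φ).open_source.mem_nhds
        he.mem_toOpenPartialHomeomorph_source, (he.toOpenPartialHomeomorph Φ).injOn⟩
  obtain ⟨t', ht', hKt', ht't⟩ := mem_nhdsSet_iff_exists.1 ht
  obtain ⟨δ, hδ, hδsub⟩ := hK.exists_thickening_subset_open (ht'.inter hS)
    (subset_inter hKt' hKS)
  set T := Metric.thickening δ K with hT_def
  have hT : IsOpen T := Metric.isOpen_thickening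
  have hinjT : InjOn Φ T := hinj.mono fun a ha => ht't (hδsub ha).1
  have hTS : T ⊆ S := fun a ha => (hδsub ha).2
  have hV : IsOpen (Φ '' T) := by
    refine isOpen_iff_mem_nhds.2 ?_
    rintro _ ⟨a, ha, rfl⟩
    obtain ⟨e, he⟩ := hstrict a (hTS ha)
    rw [← he.map_nhds_eq_of_equiv]
    exact Filter.image_mem_map (hT.mem_nhds ha)
  set g := Function.invFunOn Φ T with hg_def
  have hg : ∀ a ∈ T, g (Φ a) = a := fun a ha => hinjT.leftInvOn_invFunOn ha
  set U : Set P := (fun p => (p, (0 : E))) ⁻¹' (Φ '' T) with hU_def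
  have hsol : ∀ p x, (p, x) ∈ T → F (p, x) = 0 → x = (g (p, 0)).2 := by
    intro p x hx h0
    have := hg _ hx
    simp only [hΦ_def, h0] at this
    rw [this]
  have hUsol : ∀ p ∈ U, (p, (g (p, 0)).2) ∈ T ∧ F (p, (g (p, 0)).2) = 0 := by
    rintro p ⟨⟨q, x⟩, ha, h⟩
    obtain ⟨rfl, h0⟩ : q = p ∧ F (q, x) = 0 := Prod.ext_iff.1 h
    rw [← hsol q x ha h0]
    exact ⟨ha, h0⟩
  have hKT : ∀ p ∈ C, (p, x₀ p) ∈ T := fun p hp =>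
    Metric.self_subset_thickening hδ K ⟨p, hp, rfl⟩
  refine ⟨U, hV.preimage (by fun_prop), fun p hp => ⟨_, hKT p hp, ?_⟩, δ, hδ,
    fun p => (g (p, 0)).2, ?_, fun p hp => (hsol p _ (hKT p hp) (hzero p hp)).symm,
    fun p hp => (hUsol p hp).2, ?_⟩
  · simp [hΦ_def, hzero p hp]
  · intro p hp
    obtain ⟨haT, ha0⟩ := hUsol p hp
    obtain ⟨e, he⟩ := hstrict _ (hTS haT)
    have hgd : ContDiffAt ℝ 1 g (Φ (p, (g (p, 0)).2)) :=
      (hΦ.contDiffAt.to_localInverse he.hasFDerivAt one_ne_zero).congr_of_eventuallyEq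
        (he.localInverse_unique (Filter.eventually_of_mem (hT.mem_nhds haT) hg))
    have hgd' : ContDiffAt ℝ 1 g (p, 0) := by simpa only [hΦ_def, ha0] using hgd
    exact (contDiffAt_snd.comp p (hgd'.comp p
      (contDiffAt_id.prodMk contDiffAt_const))).contDiffWithinAt
  · intro p _ q hq x hpq hx h0
    refine hsol p x (Metric.mem_thickening_iff.2 ⟨(q, x₀ q), ⟨q, hq, rfl⟩, ?_⟩) h0
    rw [Prod.dist_eq]
    exact max_lt hpq hx

/-- An open set containing `A × {0}` with `A` compact contains a strip around it. -/
theorem exists_strip_subset {A : Set ℝ} (hA : IsCompact A) {W : Set (ℝ × ℝ)} (hW : IsOpen W)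
    (h : ∀ s ∈ A, (s, (0 : ℝ)) ∈ W) :
    ∃ ν₁ > (0 : ℝ), ∀ s ∈ A, ∀ ν ∈ Ico 0 ν₁, (s, ν) ∈ W := by
  obtain ⟨δ, hδ, hsub⟩ := (hA.prod (isCompact_singleton (x := (0 : ℝ)))).exists_thickening_subset_open
    hW (by rintro ⟨s, _⟩ ⟨hs, rfl⟩; exact h s hs)
  refine ⟨δ, hδ, fun s hs ν hν => hsub (Metric.mem_thickening_iff.2 ⟨(s, 0), ⟨hs, rfl⟩, ?_⟩)⟩
  simpa [Prod.dist_eq, abs_of_nonneg hν.1, hδ] using hν.2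

/-- A `C¹` perturbation of `s ↦ 2 - s²` has exactly one zero in `[1, 2]`, close to `√2`. -/
theorem exists_unique_root_near_sqrt_two {U : Set (ℝ × ℝ)} (hU : IsOpen U) {f : ℝ × ℝ → ℝ}
    (hf : ContDiffOn ℝ 1 f U) (hsub : ∀ s ∈ Icc (-3 : ℝ) 3, (s, (0 : ℝ)) ∈ U)
    (hf0 : ∀ s ∈ Icc (-3 : ℝ) 3, f (s, 0) = 2 - s ^ 2) :
    ∃ ν₁ > (0 : ℝ), ∃ r : ℝ → ℝ,
      (∀ ν ∈ Ico 0 ν₁, r ν ∈ Icc (1 : ℝ) 2 ∧ f (r ν, ν) = 0 ∧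
        ∀ s ∈ Icc (1 : ℝ) 2, f (s, ν) = 0 → s = r ν) ∧
      Filter.Tendsto r (nhdsWithin 0 (Ici 0)) (nhds (Real.sqrt 2)) := by
  have hfU : ContinuousOn f U := hf.continuousOn
  have hdiff : ∀ q ∈ U, HasFDerivAt f (fderiv ℝ f q) q := fun q hq =>
    ((hf.contDiffAt (hU.mem_nhds hq)).differentiableAt one_ne_zero).hasFDerivAt
  have hline : ∀ s ν, (s, ν) ∈ U →
      HasDerivAt (fun s => f (s, ν)) (fderiv ℝ f (s, ν) (1, 0)) s := fun s ν hq =>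
    (hdiff _ hq).comp_hasDerivAt s ((hasDerivAt_id s).prodMk (hasDerivAt_const s ν))
  have hder0 : ∀ s ∈ Icc (1 : ℝ) 2, fderiv ℝ f (s, 0) (1, 0) < 0 := by
    intro s hs
    have h1 := hline s 0 (hsub s ⟨by linarith [hs.1], by linarith [hs.2]⟩)
    have h2 : HasDerivAt (fun s : ℝ => 2 - s ^ 2) (-(2 * s)) s := by
      simpa using (hasDerivAt_pow 2 s).const_sub 2
    have h3 : (fun s => f (s, 0)) =ᶠ[nhds s] fun s => 2 - s ^ 2 :=
      Filter.eventually_of_mem (Icc_mem_nhds (by linarith [hs.1]) (by linarith [hs.2])) hf0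
    rw [h1.unique (h2.congr_of_eventuallyEq h3)]
    linarith [hs.1]
  have hcont' : ContinuousOn (fun q => fderiv ℝ f q (1, 0)) U :=
    (hf.continuousOn_fderiv_of_isOpen hU le_rfl).clm_apply continuousOn_const
  obtain ⟨ν₁, hν₁, hstrip⟩ := exists_strip_subset isCompact_Icc
    (hcont'.isOpen_inter_preimage hU isOpen_Iio) (A := Icc (1 : ℝ) 2)
    fun s hs => ⟨hsub s ⟨by linarith [hs.1], by linarith [hs.2]⟩, hder0 s hs⟩
  have hanti : ∀ ν ∈ Ico 0 ν₁, StrictAntiOn (fun s => f (s, ν)) (Icc 1 2) := by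
    intro ν hν
    refine strictAntiOn_of_deriv_neg (convex_Icc 1 2)
      (fun s hs => (hline s ν (hstrip s hs ν hν).1).continuousAt.continuousWithinAt)
      fun s hs => ?_
    have hs' := hstrip s (interior_subset hs) ν hν
    rw [(hline s ν hs'.1).deriv]
    exact hs'.2
  have hslice : ∀ s ∈ Icc (-3 : ℝ) 3, ContinuousAt (fun ν => f (s, ν)) 0 := fun s hs =>
    (hfU.continuousAt (hU.mem_nhds (hsub s hs))).comp (f := fun ν : ℝ => (s, ν)) (by fun_prop)
  have hev_pos : ∀ s ∈ Icc (-3 : ℝ) 3, 0 < 2 - s ^ 2 → ∀ᶠ ν in nhds 0, 0 < f (s, ν) :=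
    fun s hs h => (hslice s hs).eventually_const_lt (by simpa only [hf0 s hs] using h)
  have hev_neg : ∀ s ∈ Icc (-3 : ℝ) 3, 2 - s ^ 2 < 0 → ∀ᶠ ν in nhds 0, f (s, ν) < 0 :=
    fun s hs h => (hslice s hs).eventually_lt_const (by simpa only [hf0 s hs] using h)
  obtain ⟨ν₂, hν₂, hends⟩ := Metric.eventually_nhds_iff.1
    ((hev_pos 1 (by norm_num) (by norm_num)).and (hev_neg 2 (by norm_num) (by norm_num)))
  have hroot : ∀ ν, ∃ r, ν ∈ Ico 0 (min ν₁ ν₂) → r ∈ Icc (1 : ℝ) 2 ∧ f (r, ν) = 0 := by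
    intro ν
    by_cases hν : ν ∈ Ico 0 (min ν₁ ν₂)
    · have hνlt := lt_min_iff.1 hν.2
      have he := @hends ν (by simpa [abs_of_nonneg hν.1] using hνlt.2)
      obtain ⟨r, hr, hr0⟩ := intermediate_value_Icc' (by norm_num : (1 : ℝ) ≤ 2)
        (f := fun s => f (s, ν)) (fun s hs =>
          (hline s ν (hstrip s hs ν ⟨hν.1, hνlt.1⟩).1).continuousAt.continuousWithinAt)
        ⟨he.2.le, he.1.le⟩
      exact ⟨r, fun _ => ⟨hr, hr0⟩⟩
    · exact ⟨0, fun h => absurd h hν⟩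
  choose r hr using hroot
  have hmin : 0 < min ν₁ ν₂ := lt_min hν₁ hν₂
  have hsub₁ : ∀ ν ∈ Ico 0 (min ν₁ ν₂), ν ∈ Ico 0 ν₁ :=
    fun ν hν => ⟨hν.1, hν.2.trans_le (min_le_left _ _)⟩
  have hnear : ∀ᶠ ν in nhdsWithin (0 : ℝ) (Ici 0), ν ∈ Ico 0 (min ν₁ ν₂) :=
    Ico_mem_nhdsGE hmin
  have hsqrt : Real.sqrt 2 ^ 2 = 2 := Real.sq_sqrt (by norm_num)
  have hsqrt1 : 1 < Real.sqrt 2 := Real.one_lt_sqrt_two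
  have hsqrt2 : Real.sqrt 2 < 2 := by nlinarith
  refine ⟨min ν₁ ν₂, hmin, r, fun ν hν => ⟨(hr ν hν).1, (hr ν hν).2, fun s hs h0 =>
    (hanti ν (hsub₁ ν hν)).injOn hs (hr ν hν).1 (h0.trans (hr ν hν).2.symm)⟩,
    tendsto_order.2 ⟨fun a ha => ?_, fun b hb => ?_⟩⟩
  · have hm : max a 1 < Real.sqrt 2 := max_lt ha hsqrt1
    have hm1 : 1 ≤ max a 1 := le_max_right _ _
    filter_upwards [hnear, nhdsWithin_le_nhds (hev_pos (max a 1)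
      ⟨by linarith, by linarith⟩ (by nlinarith))] with ν hν hpos
    obtain ⟨hrI, hr0⟩ := hr ν hν
    refine (le_max_left a 1).trans_lt (not_le.1 fun hle => ?_)
    have := (hanti ν (hsub₁ ν hν)).antitoneOn hrI ⟨hm1, by linarith⟩ hle
    linarith
  · have hm : Real.sqrt 2 < min b 2 := lt_min hb hsqrt2
    have hm2 : min b 2 ≤ 2 := min_le_right _ _
    filter_upwards [hnear, nhdsWithin_le_nhds (hev_neg (min b 2)
      ⟨by linarith, by linarith⟩ (by nlinarith))] with ν hν hneg
    obtain ⟨hrI, hr0⟩ := hr ν hν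
    refine (not_le.1 fun hle => ?_ : r ν < min b 2).trans_le (min_le_left b 2)
    have := (hanti ν (hsub₁ ν hν)).antitoneOn ⟨by linarith, hm2⟩ hrI hle
    linarith

/-- A `C¹` perturbation of `s ↦ 2 - s²` has exactly two zeros in `[-2, 2]`, close to `±√2`. -/
theorem exists_two_roots_near_sqrt_two {U : Set (ℝ × ℝ)} (hU : IsOpen U) {f : ℝ × ℝ → ℝ}
    (hf : ContDiffOn ℝ 1 f U) (hsub : ∀ s ∈ Icc (-3 : ℝ) 3, (s, (0 : ℝ)) ∈ U)
    (hf0 : ∀ s ∈ Icc (-3 : ℝ) 3, f (s, 0) = 2 - s ^ 2) :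
    ∃ ν₁ > (0 : ℝ), ∃ sm sp : ℝ → ℝ,
      (∀ ν ∈ Ico 0 ν₁, sm ν ∈ Icc (-2 : ℝ) 2 ∧ sp ν ∈ Icc (-2 : ℝ) 2 ∧ sm ν ≠ sp ν ∧
        f (sm ν, ν) = 0 ∧ f (sp ν, ν) = 0 ∧
        ∀ s ∈ Icc (-2 : ℝ) 2, f (s, ν) = 0 → s = sm ν ∨ s = sp ν) ∧
      Filter.Tendsto sm (nhdsWithin 0 (Ici 0)) (nhds (-Real.sqrt 2)) ∧
      Filter.Tendsto sp (nhdsWithin 0 (Ici 0)) (nhds (Real.sqrt 2)) := by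
  obtain ⟨νp, hνp, sp, hsp, hsp_lim⟩ := exists_unique_root_near_sqrt_two hU hf hsub hf0
  have hrefl : ContDiff ℝ 1 (fun q : ℝ × ℝ => (-q.1, q.2)) := by fun_prop
  obtain ⟨νm, hνm, sm, hsm, hsm_lim⟩ := exists_unique_root_near_sqrt_two
    (hU.preimage hrefl.continuous) (hf.comp hrefl.contDiffOn (mapsTo_preimage _ _))
    (fun s hs => hsub (-s) ⟨by linarith [hs.2], by linarith [hs.1]⟩)
    (fun s hs => by
      simpa using hf0 (-s) ⟨by linarith [hs.2], by linarith [hs.1]⟩)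
  obtain ⟨νc, hνc, hpos⟩ := exists_strip_subset isCompact_Icc
    (hf.continuousOn.isOpen_inter_preimage hU (isOpen_Ioi (a := 0))) (A := Icc (-1 : ℝ) 1)
    (fun s hs => by
      have hs3 : s ∈ Icc (-3 : ℝ) 3 := ⟨by linarith [hs.1], by linarith [hs.2]⟩
      refine ⟨hsub s hs3, ?_⟩
      rw [mem_preimage, hf0 s hs3, mem_Ioi]
      nlinarith [hs.1, hs.2])
  refine ⟨min νp (min νm νc), by positivity, fun ν => -sm ν, sp, ?_, hsm_lim.neg, hsp_lim⟩
  rintro ν ⟨hν0, hν⟩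
  simp only [lt_min_iff] at hν
  obtain ⟨hpI, hp0, hpu⟩ := hsp ν ⟨hν0, hν.1⟩
  obtain ⟨hmI, hm0, hmu⟩ := hsm ν ⟨hν0, hν.2.1⟩
  refine ⟨⟨by linarith [hmI.2], by linarith [hmI.1]⟩, ⟨by linarith [hpI.1], hpI.2⟩,
    ne_of_lt (by linarith [hpI.1, hmI.1]), hm0, hp0, fun s hs h0 => ?_⟩
  rcases le_or_gt 1 s with h1 | h1
  · exact Or.inr (hpu s ⟨h1, hs.2⟩ h0)
  rcases le_or_gt s (-1) with h2 | h2
  · refine Or.inl ?_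
    have := hmu (-s) ⟨by linarith, by linarith [hs.1]⟩ (by simpa using h0)
    linarith
  · have := (hpos s ⟨h2.le, h1.le⟩ ν ⟨hν0, hν.2.2⟩).2
    rw [mem_preimage, h0] at this
    exact absurd this self_notMem_Ioi

/-- Fold-region chart `μ̃ = 2`: the rescaled fold system is solvable for
`(σ_1, …, σ_{k−1}, ε̃)` in terms of `σ_k = s ∈ [−2, 2]` and small `ν ≥ 0`,
near the explicit solution `ε̃ = 2 − s²`, `σ_n = √2`; these solutions are
locally unique, and for each small `ν` the equation `ε̃(s, ν) = 0` has exactly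
two roots `s^±(ν)` in `[−2, 2]`, converging to `±√2` as `ν → 0`. -/
theorem fold_chart_mu (k : ℕ) (hk : 1 ≤ k)
    (R : (Fin k → ℝ) × ℝ × ℝ → Fin k → ℝ) (hR : ContDiff ℝ 1 R) :
    ∃ ν0 > (0:ℝ), ∃ δ > (0:ℝ),
      ∃ et : ℝ × ℝ → ℝ, ∃ sg : Fin k → ℝ × ℝ → ℝ,
        ContDiffOn ℝ 1 et (Icc (-2:ℝ) 2 ×ˢ Ico (0:ℝ) ν0) ∧
        (∀ i : Fin k, (i : ℕ) + 1 < k →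
          ContDiffOn ℝ 1 (sg i) (Icc (-2:ℝ) 2 ×ˢ Ico (0:ℝ) ν0)) ∧
        (∀ s ∈ Icc (-2:ℝ) 2, et (s, 0) = 2 - s ^ 2 ∧
          ∀ i : Fin k, (i : ℕ) + 1 < k → sg i (s, 0) = Real.sqrt 2) ∧
        (∀ s ∈ Icc (-2:ℝ) 2, ∀ ν ∈ Ico (0:ℝ) ν0,
          GfoldMu k R (fun i => if (i : ℕ) + 1 < k then sg i (s, ν) else s)
            (et (s, ν)) ν = 0) ∧
        (∀ s ∈ Icc (-2:ℝ) 2, ∀ ν ∈ Ico (0:ℝ) ν0, ∀ σ : Fin k → ℝ, ∀ et' : ℝ,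
          σ ⟨k - 1, by omega⟩ = s →
          GfoldMu k R σ et' ν = 0 →
          |et' - (2 - s ^ 2)| < δ →
          (∀ i : Fin k, (i : ℕ) + 1 < k → |σ i - Real.sqrt 2| < δ) →
          et' = et (s, ν) ∧
            σ = fun i : Fin k => if (i : ℕ) + 1 < k then sg i (s, ν) else s) ∧
        ∃ sm sp : ℝ → ℝ,
          (∀ ν ∈ Ico (0:ℝ) ν0,
            sm ν ∈ Icc (-2:ℝ) 2 ∧ sp ν ∈ Icc (-2:ℝ) 2 ∧ sm ν ≠ sp ν ∧
            et (sm ν, ν) = 0 ∧ et (sp ν, ν) = 0 ∧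
            ∀ s ∈ Icc (-2:ℝ) 2, et (s, ν) = 0 → s = sm ν ∨ s = sp ν) ∧
          Filter.Tendsto sm (nhdsWithin 0 (Ico (0:ℝ) ν0))
            (nhds (-Real.sqrt 2)) ∧
          Filter.Tendsto sp (nhdsWithin 0 (Ico (0:ℝ) ν0))
            (nhds (Real.sqrt 2)) := by
  have hklt : k - 1 < k := by omega
  set last : Fin k := ⟨k - 1, hklt⟩ with hlast_def
  have hlast : ∀ i : Fin k, ¬ (i : ℕ) + 1 < k → i = last := fun i hi =>
    Fin.ext (by simp only [hlast_def]; omega)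
  have hlast' : ¬ ((last : ℕ) + 1 < k) := by simp only [hlast_def]; omega
  set F : (ℝ × ℝ) × (Fin k → ℝ) → Fin k → ℝ := fun a =>
    GfoldMu k R (fun i => if (i : ℕ) + 1 < k then a.2 i else a.1.1) (a.2 last) a.1.2 with hF_def
  set x₀ : ℝ × ℝ → Fin k → ℝ := fun p i =>
    if (i : ℕ) + 1 < k then Real.sqrt 2 else 2 - p.1 ^ 2 with hx₀_def
  have hσ : ContDiff ℝ 1 (fun (a : (ℝ × ℝ) × (Fin k → ℝ)) (i : Fin k) =>
      if (i : ℕ) + 1 < k then a.2 i else a.1.1) := by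
    refine contDiff_pi.2 fun i => ?_
    split_ifs <;> fun_prop
  have hF : ContDiff ℝ 1 F := by
    refine contDiff_pi.2 fun i => ?_
    have hRi : ContDiff ℝ 1 (fun a : (ℝ × ℝ) × (Fin k → ℝ) =>
        R (fun i => if (i : ℕ) + 1 < k then a.2 i else a.1.1, a.2 last, a.1.2) i) :=
      (contDiff_apply ℝ ℝ i).comp (hR.comp (hσ.prodMk (by fun_prop)))
    have hνR := (contDiff_fst.snd (𝕜 := ℝ)).mul hRi
    by_cases hi : (i : ℕ) + 1 < k <;> simp only [hF_def, GfoldMu, hi, if_true, if_false] <;>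
      exact ContDiff.add (by fun_prop) hνR
  set C : Set (ℝ × ℝ) := Icc (-3 : ℝ) 3 ×ˢ {0} with hC_def
  have hx₀ : Continuous x₀ := by
    refine continuous_pi fun i => ?_
    by_cases hi : (i : ℕ) + 1 < k <;> simp only [hx₀_def, hi, if_true, if_false] <;> fun_prop
  have hzero : ∀ p ∈ C, F (p, x₀ p) = 0 := by
    rintro ⟨s, _⟩ ⟨-, rfl⟩
    funext i
    by_cases hi : (i : ℕ) + 1 < k <;> simp [hF_def, GfoldMu, hx₀_def, hi, hlast']
  have hinv : ∀ p ∈ C, ∃ D : (Fin k → ℝ) ≃L[ℝ] (Fin k → ℝ),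
      HasFDerivAt (fun x => F (p, x)) (D : (Fin k → ℝ) →L[ℝ] (Fin k → ℝ)) (x₀ p) := by
    rintro ⟨s, _⟩ ⟨-, rfl⟩
    refine ⟨ContinuousLinearEquiv.piCongrRight fun i => ContinuousLinearEquiv.unitsEquivAut ℝ
      (if (i : ℕ) + 1 < k then Units.mk0 (-(2 * Real.sqrt 2)) (by simp) else -1), ?_⟩
    refine hasFDerivAt_pi'.2 fun i => ?_
    by_cases hi : (i : ℕ) + 1 < k
    · have h := ((hasFDerivAt_apply (𝕜 := ℝ) i (x₀ (s, 0))).pow 2).const_sub 2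
      refine (h.congr_of_eventuallyEq (.of_forall fun x => ?_)).congr_fderiv ?_
      · simp [hF_def, GfoldMu, hi]
      · ext v
        simp [hi, hx₀_def]
        ring
    · have h := (hasFDerivAt_apply (𝕜 := ℝ) i (x₀ (s, 0))).const_sub (2 - s ^ 2)
      refine (h.congr_of_eventuallyEq (.of_forall fun x => ?_)).congr_fderiv ?_
      · simp [hF_def, GfoldMu, hi, ← hlast i hi]
      · ext v
        simp [hi]
  obtain ⟨U, hU, hCU, δ, hδ, X, hX, hX0, hXF, huniq⟩ := exists_implicitFunction_nhds_compact hF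
    (isCompact_Icc.prod isCompact_singleton) hx₀.continuousOn hzero hinv
  have hXi : ∀ i, ContDiffOn ℝ 1 (fun p => X p i) U := contDiffOn_pi.1 hX
  have hsub : ∀ s ∈ Icc (-3 : ℝ) 3, (s, (0 : ℝ)) ∈ U := fun s hs => hCU ⟨hs, rfl⟩
  obtain ⟨ν₁, hν₁, sm, sp, hroots, hsm, hsp⟩ := exists_two_roots_near_sqrt_two hU (hXi last) hsub
    fun s hs => by
      simp only [hX0 (s, 0) ⟨hs, rfl⟩]
      exact if_neg hlast'
  obtain ⟨ν₂, hν₂, hstrip⟩ := exists_strip_subset isCompact_Icc hU hsub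
  have h23 : ∀ s ∈ Icc (-2 : ℝ) 2, s ∈ Icc (-3 : ℝ) 3 := fun s hs =>
    ⟨by linarith [hs.1], by linarith [hs.2]⟩
  have hlt : ∀ ν ∈ Ico 0 (min ν₁ (min ν₂ δ)), 0 ≤ ν ∧ ν < ν₁ ∧ ν < ν₂ ∧ ν < δ := fun ν hν =>
    ⟨hν.1, by simpa only [lt_min_iff] using hν.2⟩
  have hmem : ∀ s ∈ Icc (-2 : ℝ) 2, ∀ ν ∈ Ico 0 (min ν₁ (min ν₂ δ)), (s, ν) ∈ U :=
    fun s hs ν hν => hstrip s (h23 s hs) ν ⟨hν.1, (hlt ν hν).2.2.1⟩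
  have hprod : Icc (-2 : ℝ) 2 ×ˢ Ico 0 (min ν₁ (min ν₂ δ)) ⊆ U := fun p hp =>
    hmem p.1 hp.1 p.2 hp.2
  have hmono : nhdsWithin (0 : ℝ) (Ico 0 (min ν₁ (min ν₂ δ))) ≤ nhdsWithin 0 (Ici 0) :=
    nhdsWithin_mono 0 Ico_subset_Ici_self
  refine ⟨min ν₁ (min ν₂ δ), by positivity, δ, hδ, fun p => X p last, fun i p => X p i,
    (hXi last).mono hprod, fun i _ => (hXi i).mono hprod, fun s hs => ?_,
    fun s hs ν hν => hXF _ (hmem s hs ν hν), ?_, sm, sp,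
    fun ν hν => hroots ν ⟨hν.1, (hlt ν hν).2.1⟩, hsm.mono_left hmono, hsp.mono_left hmono⟩
  · simp only [hX0 (s, 0) ⟨h23 s hs, rfl⟩]
    exact ⟨if_neg hlast', fun i hi => if_pos hi⟩
  · intro s hs ν hν σ et' hσs hG het hσδ
    set x : Fin k → ℝ := fun i => if (i : ℕ) + 1 < k then σ i else et' with hx_def
    have hσx : (fun i : Fin k => if (i : ℕ) + 1 < k then x i else s) = σ := by
      funext i
      by_cases hi : (i : ℕ) + 1 < k
      · simp [hx_def, hi]
      · rw [if_neg hi, hlast i hi, hσs]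
    have hxlast : x last = et' := if_neg hlast'
    have hx : x = X (s, ν) := by
      refine huniq _ (hmem s hs ν hν) (s, 0) ⟨h23 s hs, rfl⟩ x ?_ ?_ ?_
      · simpa [Prod.dist_eq, abs_of_nonneg hν.1, hδ] using (hlt ν hν).2.2.2
      · refine (dist_pi_lt_iff hδ).2 fun i => ?_
        by_cases hi : (i : ℕ) + 1 < k
        · simpa [hx_def, hx₀_def, hi, Real.dist_eq] using hσδ i hi
        · simpa only [hx_def, hx₀_def, hi, if_false, Real.dist_eq] using het
      · simp only [hF_def, hσx, hxlast]
        exact hG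
    simp only [← hx, hxlast, hσx, and_self]
end
end

section
/- Persistence of the Hopf-region fold under perturbation: Let R : ℝ × ℝ × ℝ → ℝ be twice continuously differentiable and define g(σ, μ̃, ν) = −μ̃ σ + σ³ + 1 + ν R(σ, μ̃, ν). Then there exist ν_0 > 0 and continuously differentiable functions σ^fold, μ̃^fold : [0, ν_0) → ℝ with σ^fold(0) = 2^{−1/3} and μ̃^fold(0) = 3 · 2^{−2/3} such that g(σ^fold(ν), μ̃^fold(ν), ν) = 0 and ∂_σ g(σ^fold(ν), μ̃^fold(ν), ν) = 0 for all ν ∈ [0, ν_0), and (σ^fold(ν), μ̃^fold(ν)) is the unique solution of this pair of equations in a neighborhood of (2^{−1/3}, 3 · 2^{−2/3}). -/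
noncomputable section

open Set

/-- The perturbed Hopf-region amplitude function
`g(σ, μ̃, ν) = −μ̃σ + σ³ + 1 + νR(σ, μ̃, ν)`. -/
def gHopf (R : ℝ × ℝ × ℝ → ℝ) (σ μt ν : ℝ) : ℝ :=
  -μt * σ + σ ^ 3 + 1 + ν * R (σ, μt, ν)

/-- The pair `(g, ∂_σ g)` as a function of `(ν, (σ, μ̃))`. -/
def foldMap (R : ℝ × ℝ × ℝ → ℝ) (v : ℝ × ℝ × ℝ) : ℝ × ℝ :=
  (gHopf R v.2.1 v.2.2 v.1,
    -v.2.2 + 3 * v.2.1 ^ 2 + v.1 * fderiv ℝ R (v.2.1, v.2.2, v.1) (1, 0, 0))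

lemma hasDerivAt_gHopf {R : ℝ × ℝ × ℝ → ℝ} (hR : Differentiable ℝ R) (σ μt ν : ℝ) :
    HasDerivAt (fun x => gHopf R x μt ν) (foldMap R (ν, σ, μt)).2 σ := by
  have hcurve : HasDerivAt (fun x : ℝ => (x, μt, ν)) (1, 0, 0) σ :=
    (hasDerivAt_id σ).prodMk ((hasDerivAt_const σ μt).prodMk (hasDerivAt_const σ ν))
  have hRσ : HasDerivAt (fun x => R (x, μt, ν)) (fderiv ℝ R (σ, μt, ν) (1, 0, 0)) σ :=
    (hR (σ, μt, ν)).hasFDerivAt.comp_hasDerivAt σ hcurve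
  have h := ((((hasDerivAt_id σ).const_mul (-μt)).add (hasDerivAt_pow 3 σ)).add_const 1).add
    (hRσ.const_mul ν)
  refine h.congr_deriv ?_
  simp [foldMap]

lemma foldMap_eq_zero_iff {R : ℝ × ℝ × ℝ → ℝ} (hR : Differentiable ℝ R) (σ μt ν : ℝ) :
    foldMap R (ν, σ, μt) = 0 ↔
      gHopf R σ μt ν = 0 ∧ deriv (fun x => gHopf R x μt ν) σ = 0 := by
  rw [(hasDerivAt_gHopf hR σ μt ν).deriv, Prod.ext_iff]
  rfl

lemma contDiff_foldMap {R : ℝ × ℝ × ℝ → ℝ} (hR : ContDiff ℝ 2 R) :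
    ContDiff ℝ 1 (foldMap R) := by
  have hR₁ : ContDiff ℝ 1 R := hR.of_le one_le_two
  have hfderiv : ContDiff ℝ 1 (fderiv ℝ R) := hR.fderiv_right (by norm_num)
  unfold foldMap gHopf
  fun_prop

/-- The Jacobian of `(g, ∂_σ g)` in `(σ, μ̃)` at a point with `ν = 0` and `μ̃ = 3σ²`. -/
def foldJacobian (s : ℝ) : ℝ × ℝ →L[ℝ] ℝ × ℝ :=
  ((-s) • ContinuousLinearMap.snd ℝ ℝ ℝ).prod
    ((6 * s) • ContinuousLinearMap.fst ℝ ℝ ℝ - ContinuousLinearMap.snd ℝ ℝ ℝ)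

lemma isInvertible_foldJacobian {s : ℝ} (hs : s ≠ 0) : (foldJacobian s).IsInvertible := by
  refine ⟨ContinuousLinearEquiv.equivOfInverse (foldJacobian s)
    (((6 * s)⁻¹ • (ContinuousLinearMap.snd ℝ ℝ ℝ - s⁻¹ • ContinuousLinearMap.fst ℝ ℝ ℝ)).prod
      ((-s⁻¹) • ContinuousLinearMap.fst ℝ ℝ ℝ)) ?_ ?_, rfl⟩
  · rintro ⟨a, b⟩
    ext <;> simp [foldJacobian] <;> field_simp <;> ring
  · rintro ⟨a, b⟩
    ext <;> simp [foldJacobian] <;> field_simp <;> ring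

lemma fderiv_foldMap_comp_inr {R : ℝ × ℝ × ℝ → ℝ} (hR : ContDiff ℝ 2 R) (s : ℝ) :
    fderiv ℝ (foldMap R) (0, s, 3 * s ^ 2) ∘L .inr ℝ ℝ (ℝ × ℝ) = foldJacobian s := by
  have hinr : HasFDerivAt (fun w : ℝ × ℝ => ((0 : ℝ), w)) (.inr ℝ ℝ (ℝ × ℝ)) (s, 3 * s ^ 2) :=
    hasFDerivAt_prodMk_right _ _
  have hdiff : DifferentiableAt ℝ (foldMap R) (0, s, 3 * s ^ 2) :=
    (contDiff_foldMap hR).differentiable one_ne_zero _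
  have hcomp := hdiff.hasFDerivAt.comp (s, 3 * s ^ 2) hinr
  refine hcomp.unique ?_
  have hσ : HasFDerivAt (fun w : ℝ × ℝ => w.1) (.fst ℝ ℝ ℝ) (s, 3 * s ^ 2) := hasFDerivAt_fst
  have hμ : HasFDerivAt (fun w : ℝ × ℝ => w.2) (.snd ℝ ℝ ℝ) (s, 3 * s ^ 2) := hasFDerivAt_snd
  have h := (((hμ.neg.mul hσ).add (hσ.pow 3)).add_const 1).prodMk
    (hμ.neg.add ((hσ.pow 2).const_mul 3))
  refine (h.congr_fderiv ?_).congr_of_eventuallyEq (.of_forall fun w => ?_)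
  · ext <;> simp [foldJacobian] <;> ring
  · simp [foldMap, gHopf]

/-- Persistence of the Hopf-region fold under perturbation: for small `ν ≥ 0`
there is a `C¹` family of fold points `(σ^fold(ν), μ̃^fold(ν))`, starting at
`(2^{−1/3}, 3·2^{−2/3})`, at which `g` and `∂_σ g` vanish simultaneously, and
which is the unique such solution near the unperturbed fold. -/
theorem hopf_fold_persists (R : ℝ × ℝ × ℝ → ℝ) (hR : ContDiff ℝ 2 R) :
    ∃ ν0 > (0:ℝ), ∃ δ > (0:ℝ), ∃ sf mf : ℝ → ℝ,
      ContDiffOn ℝ 1 sf (Ico (0:ℝ) ν0) ∧ ContDiffOn ℝ 1 mf (Ico (0:ℝ) ν0) ∧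
      sf 0 = (2 : ℝ) ^ (-(1 : ℝ) / 3) ∧ mf 0 = 3 * (2 : ℝ) ^ (-(2 : ℝ) / 3) ∧
      ∀ ν ∈ Ico (0:ℝ) ν0,
        gHopf R (sf ν) (mf ν) ν = 0 ∧
        deriv (fun σ => gHopf R σ (mf ν) ν) (sf ν) = 0 ∧
        ∀ σ μt : ℝ, |σ - (2 : ℝ) ^ (-(1 : ℝ) / 3)| < δ →
          |μt - 3 * (2 : ℝ) ^ (-(2 : ℝ) / 3)| < δ →
          gHopf R σ μt ν = 0 →
          deriv (fun x => gHopf R x μt ν) σ = 0 →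
          σ = sf ν ∧ μt = mf ν := by
  have hdiff : Differentiable ℝ R := hR.differentiable two_ne_zero
  have hm : (2 : ℝ) ^ (-(2 : ℝ) / 3) = ((2 : ℝ) ^ (-(1 : ℝ) / 3)) ^ 2 := by
    rw [← Real.rpow_mul_natCast zero_le_two]
    norm_num
  have hs3 : ((2 : ℝ) ^ (-(1 : ℝ) / 3)) ^ 3 = 1 / 2 := by
    rw [← Real.rpow_mul_natCast zero_le_two]
    norm_num [Real.rpow_neg_one]
  have hs : (2 : ℝ) ^ (-(1 : ℝ) / 3) ≠ 0 := by positivity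
  rw [hm]
  generalize (2 : ℝ) ^ (-(1 : ℝ) / 3) = s at hs3 hs ⊢
  have hzero : foldMap R (0, s, 3 * s ^ 2) = 0 := by
    ext
    · simp only [foldMap, gHopf, Prod.fst_zero]
      linear_combination (-2) * hs3
    · simp [foldMap]
  have hF : ContDiffAt ℝ 1 (foldMap R) (0, s, 3 * s ^ 2) := (contDiff_foldMap hR).contDiffAt
  have hinv : (fderiv ℝ (foldMap R) (0, s, 3 * s ^ 2) ∘L .inr ℝ ℝ (ℝ × ℝ)).IsInvertible := by
    rw [fderiv_foldMap_comp_inr hR]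
    exact isInvertible_foldJacobian hs
  have hself := hF.implicitFunction_apply_self one_ne_zero hinv
  have hsol := hF.eventually_apply_implicitFunction one_ne_zero hinv
  have huniq := hF.eventually_apply_eq_iff_implicitFunction one_ne_zero hinv
  have hsmooth := (hF.contDiffAt_implicitFunction one_ne_zero hinv).eventually (by simp)
  generalize hF.implicitFunction one_ne_zero hinv = ψ at hself hsol huniq hsmooth
  obtain ⟨ε, hε, hball⟩ := Metric.eventually_nhds_iff.mp (hsol.and hsmooth)
  obtain ⟨δ, hδ, huniq⟩ := Metric.eventually_nhds_iff.mp huniq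
  have hnear {ν : ℝ} (hν : ν ∈ Ico 0 (min ε δ)) : dist ν 0 < ε ∧ dist ν 0 < δ := by
    rw [Real.dist_0_eq_abs, abs_of_nonneg hν.1]
    exact lt_min_iff.mp hν.2
  have hψ : ContDiffOn ℝ 1 ψ (Ico 0 (min ε δ)) := fun ν hν =>
    (hball (hnear hν).1).2.contDiffWithinAt
  refine ⟨min ε δ, lt_min hε hδ, δ, hδ, fun ν => (ψ ν).1, fun ν => (ψ ν).2, hψ.fst, hψ.snd,
    congrArg Prod.fst hself, congrArg Prod.snd hself, fun ν hν => ?_⟩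
  obtain ⟨hg, hg'⟩ := (foldMap_eq_zero_iff hdiff (ψ ν).1 (ψ ν).2 ν).mp
    ((hball (hnear hν).1).1.trans hzero)
  refine ⟨hg, hg', fun σ μt hσ hμ h₁ h₂ => ?_⟩
  have hdist : dist (ν, σ, μt) (0, s, 3 * s ^ 2) < δ :=
    max_lt (hnear hν).2 (max_lt hσ hμ)
  have heq := (huniq hdist).mp
    (((foldMap_eq_zero_iff hdiff σ μt ν).mpr ⟨h₁, h₂⟩).trans hzero.symm)
  exact ⟨(congrArg Prod.fst heq).symm, (congrArg Prod.snd heq).symm⟩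
end
end

section
/- Reduced core system for conservative coupling near the fold at μ = 1: Let k ≥ 4 and κ ∈ {−1, +1}. Set Ω = 2, φ_n = −π/2 for 1 ≤ n ≤ k−2, φ_{k−1} = κπ/2, and φ_0 = −φ_1. Then the phase equations 0 = Ω + cos φ_n + cos φ_{n−1} − 2 (1 ≤ n ≤ k−1) and 0 = Ω + cos φ_{k−1} − 2 are satisfied, and the amplitude equations 0 = μ̃ − σ_n² + sin φ_{n−1} − sin φ_n (1 ≤ n ≤ k−1) and 0 = μ̃ − σ_k² + sin φ_{k−1} become exactly: 0 = μ̃ − σ_1² + 2; 0 = μ̃ − σ_n² for 2 ≤ n ≤ k−2; 0 = μ̃ − σ_{k−1}² − 1 − κ; 0 = μ̃ − σ_k² + κ. Consequently, this amplitude system has a real solution σ ∈ ℝ^k if and only if μ̃ ≥ 2 when κ = +1 and μ̃ ≥ 1 when κ = −1; at the minimal value of μ̃ the vanishing component is σ_{k−1} when κ = +1 and σ_k when κ = −1. -/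
noncomputable section

open Real

/-- The reduced core amplitude system for conservative coupling near the fold
at `μ = 1`, after substituting the phase solution:
`μ̃ − σ₁² + 2 = 0`, `μ̃ − σ_n² = 0` for `2 ≤ n ≤ k−2`,
`μ̃ − σ_{k−1}² − 1 − κ = 0`, and `μ̃ − σ_k² + κ = 0`. -/
def ConsAmpSys (k : ℕ) (κ μt : ℝ) (σ : ℕ → ℝ) : Prop :=
  μt - (σ 1) ^ 2 + 2 = 0 ∧
  (∀ n, 2 ≤ n → n ≤ k - 2 → μt - (σ n) ^ 2 = 0) ∧
  μt - (σ (k - 1)) ^ 2 - 1 - κ = 0 ∧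
  μt - (σ k) ^ 2 + κ = 0

/-- The reduced amplitude system is solvable iff each of the prescribed squares is nonnegative. -/
theorem exists_consAmpSys_iff {k : ℕ} (hk : 4 ≤ k) (κ μt : ℝ) :
    (∃ σ : ℕ → ℝ, ConsAmpSys k κ μt σ) ↔
      0 ≤ μt ∧ 0 ≤ μt - 1 - κ ∧ 0 ≤ μt + κ := by
  constructor
  · rintro ⟨σ, -, hmid, hpre, hlast⟩
    have h2 := hmid 2 le_rfl (by omega)
    refine ⟨?_, ?_, ?_⟩
    · linarith [sq_nonneg (σ 2)]
    · linarith [sq_nonneg (σ (k - 1))]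
    · linarith [sq_nonneg (σ k)]
  · rintro ⟨hmid, hpre, hlast⟩
    refine ⟨fun n => if n = 1 then √(μt + 2) else if n = k then √(μt + κ)
      else if n = k - 1 then √(μt - 1 - κ) else √μt, ?_, ?_, ?_, ?_⟩
    · beta_reduce
      rw [if_pos rfl, sq_sqrt (by linarith)]
      ring
    · intro n hn hnk
      beta_reduce
      rw [if_neg (by omega), if_neg (by omega), if_neg (by omega), sq_sqrt hmid]
      ring
    · beta_reduce
      rw [if_neg (by omega), if_neg (by omega), if_pos rfl, sq_sqrt hpre]
      ring
    · beta_reduce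
      rw [if_neg (by omega), if_pos rfl, sq_sqrt hlast]
      ring

/-- The core indices are the first one, the interior ones, and the last two. -/
theorem core_index_cases {k n : ℕ} (hn : 1 ≤ n) (hnk : n ≤ k) :
    n = 1 ∨ (2 ≤ n ∧ n ≤ k - 2) ∨ n = k - 1 ∨ n = k := by
  omega

/-- Reduced core system for conservative coupling near the fold at `μ = 1`:
with `Ω = 2`, `φ_n = −π/2` for `1 ≤ n ≤ k−2`, `φ_{k−1} = κπ/2`, and the
on-site convention `φ₀ = −φ₁`, the phase equations hold, the amplitude
equations are equivalent to the reduced system `ConsAmpSys`, the reduced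
system is solvable iff `μ̃ ≥ 2` (for `κ = +1`) resp. `μ̃ ≥ 1` (for `κ = −1`),
and at the minimal value of `μ̃` the vanishing component is `σ_{k−1}` for
`κ = +1` and `σ_k` for `κ = −1`. -/
theorem conservative_fold_core (k : ℕ) (hk : 4 ≤ k) (κ : ℝ)
    (hκ : κ = 1 ∨ κ = -1) (φ : ℕ → ℝ)
    (hφmid : ∀ n, 1 ≤ n → n ≤ k - 2 → φ n = -(π / 2))
    (hφlast : φ (k - 1) = κ * (π / 2)) (hφ0 : φ 0 = -φ 1) :
    ((∀ n, 1 ≤ n → n ≤ k - 1 →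
        (2 : ℝ) + Real.cos (φ n) + Real.cos (φ (n - 1)) - 2 = 0) ∧
      (2 : ℝ) + Real.cos (φ (k - 1)) - 2 = 0) ∧
    (∀ σ : ℕ → ℝ, ∀ μt : ℝ,
      ((∀ n, 1 ≤ n → n ≤ k - 1 →
          μt - (σ n) ^ 2 + Real.sin (φ (n - 1)) - Real.sin (φ n) = 0) ∧
        μt - (σ k) ^ 2 + Real.sin (φ (k - 1)) = 0) ↔
      ConsAmpSys k κ μt σ) ∧
    (∀ μt : ℝ,
      (κ = 1 → ((∃ σ : ℕ → ℝ, ConsAmpSys k κ μt σ) ↔ 2 ≤ μt)) ∧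
      (κ = -1 → ((∃ σ : ℕ → ℝ, ConsAmpSys k κ μt σ) ↔ 1 ≤ μt))) ∧
    (κ = 1 → ∀ σ : ℕ → ℝ, ConsAmpSys k κ 2 σ →
      σ (k - 1) = 0 ∧ ∀ n, 1 ≤ n → n ≤ k → n ≠ k - 1 → σ n ≠ 0) ∧
    (κ = -1 → ∀ σ : ℕ → ℝ, ConsAmpSys k κ 1 σ →
      σ k = 0 ∧ ∀ n, 1 ≤ n → n ≤ k → n ≠ k → σ n ≠ 0) := by
  have hsin_mid : ∀ n, 1 ≤ n → n ≤ k - 2 → sin (φ n) = -1 := fun n h1 h2 => by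
    rw [hφmid n h1 h2, sin_neg, sin_pi_div_two]
  have hsin_last : sin (φ (k - 1)) = κ := by
    rcases hκ with rfl | rfl <;> simp [hφlast]
  have hsin_zero : sin (φ 0) = 1 := by
    rw [hφ0, sin_neg, hsin_mid 1 le_rfl (by omega), neg_neg]
  have hcos_last : cos (φ (k - 1)) = 0 := by
    rcases hκ with rfl | rfl <;> simp [hφlast]
  have hcos : ∀ n, n ≤ k - 1 → cos (φ n) = 0 := by
    intro n hn
    have hcos_mid : ∀ m, 1 ≤ m → m ≤ k - 2 → cos (φ m) = 0 := fun m h1 h2 => by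
      rw [hφmid m h1 h2, cos_neg, cos_pi_div_two]
    obtain rfl | rfl | ⟨h1, h2⟩ : n = 0 ∨ n = k - 1 ∨ (1 ≤ n ∧ n ≤ k - 2) := by omega
    · rw [hφ0, cos_neg, hcos_mid 1 le_rfl (by omega)]
    · exact hcos_last
    · exact hcos_mid n h1 h2
  refine ⟨⟨fun n _ hn => ?_, ?_⟩, fun σ μt => ⟨?_, ?_⟩, fun μt => ⟨?_, ?_⟩, ?_, ?_⟩
  · rw [hcos n hn, hcos (n - 1) (by omega)]
    ring
  · rw [hcos_last]
    ring
  · rintro ⟨h, hlast⟩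
    refine ⟨?_, fun n hn hnk => ?_, ?_, ?_⟩
    · have h1 := h 1 le_rfl (by omega)
      rw [Nat.sub_self, hsin_zero, hsin_mid 1 le_rfl (by omega)] at h1
      linarith
    · have hn' := h n (by omega) (by omega)
      rw [hsin_mid (n - 1) (by omega) (by omega), hsin_mid n (by omega) hnk] at hn'
      linarith
    · have hpre := h (k - 1) (by omega) le_rfl
      rw [hsin_mid (k - 1 - 1) (by omega) (by omega), hsin_last] at hpre
      linarith
    · rwa [hsin_last] at hlast
  · rintro ⟨hfirst, hmid, hpre, hlast⟩
    refine ⟨fun n hn hnk => ?_, by rwa [hsin_last]⟩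
    obtain rfl | ⟨h2, hk2⟩ | rfl | rfl := core_index_cases hn (hnk.trans (Nat.sub_le k 1))
    · rw [Nat.sub_self, hsin_zero, hsin_mid 1 le_rfl (by omega)]
      linarith
    · rw [hsin_mid (n - 1) (by omega) (by omega), hsin_mid n hn hk2]
      linarith [hmid n h2 hk2]
    · rw [hsin_mid (k - 1 - 1) (by omega) (by omega), hsin_last]
      linarith
    · omega
  · rintro rfl
    rw [exists_consAmpSys_iff hk]
    exact ⟨fun h => by linarith [h.2.1], fun h => ⟨by linarith, by linarith, by linarith⟩⟩
  · rintro rfl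
    rw [exists_consAmpSys_iff hk]
    exact ⟨fun h => by linarith [h.2.2], fun h => ⟨by linarith, by linarith, by linarith⟩⟩
  · rintro rfl σ ⟨hfirst, hmid, hpre, hlast⟩
    refine ⟨pow_eq_zero_iff two_ne_zero |>.mp (by linarith), fun n hn hnk hne h0 => ?_⟩
    obtain rfl | ⟨h2, hk2⟩ | rfl | rfl := core_index_cases hn hnk
    · norm_num [h0] at hfirst
    · have := hmid n h2 hk2
      norm_num [h0] at this
    · exact hne rfl
    · norm_num [h0] at hlast
  · rintro rfl σ ⟨hfirst, hmid, hpre, hlast⟩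
    refine ⟨pow_eq_zero_iff two_ne_zero |>.mp (by linarith), fun n hn hnk hne h0 => ?_⟩
    obtain rfl | ⟨h2, hk2⟩ | rfl | rfl := core_index_cases hn hnk
    · norm_num [h0] at hfirst
    · have := hmid n h2 hk2
      norm_num [h0] at this
    · norm_num [h0] at hpre
    · exact hne rfl
end
end
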